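/- Let (R, 𝔪) be a generalized Cohen–Macaulay Noetherian local ring of dimension d ≥ 2 with infinite residue field, and let 𝔮 = (x₁, …, x_d) be a standard parameter ideal of R such that I² = 𝔮I, where I = 𝔮 :_R 𝔪, and such that 𝒩(𝔮;R) = Σ_{i=0}^d C(d,i)·r_i(R). Then e₁(I) − e₁(𝔮) = f₀(𝔮) = Σ_{j=1}^d C(d−1, j−1)·r_j(R). -/

import Mathlib

open CategoryTheory IsLocalRing

noncomputable section

/-- The length of a module, defined as the Krull dimension of its submodule lattice. -/
def moduleLength (R M : Type) [CommRing R] [AddCommGroup M] [Module R M] : WithBot ℕ∞ :=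
  Order.krullDim (Submodule R M)

variable (R : Type) [CommRing R] [IsLocalRing R]

/-- `q` is a parameter ideal of the `d`-dimensional local ring `R`:
it is generated by `d` elements and is `𝔪`-primary (its radical is `𝔪`). -/
def IsParameterIdeal (d : ℕ) (q : Ideal R) : Prop :=
  (∃ x : Fin d → R, q = Ideal.span (Set.range x)) ∧ q.radical = maximalIdeal R

/-- `e` is the sequence of Hilbert coefficients of the `𝔪`-primary ideal `I`:
for all large `n`, `ℓ(R/Iⁿ⁺¹) = Σ_{i=0}^d (-1)^i e_i C(n+d-i, d-i)`. -/
def IsHilbertCoeffs (d : ℕ) (I : Ideal R) (e : ℕ → ℤ) : Prop :=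
  ∃ N : ℕ, ∀ n ≥ N, ∃ L : ℕ,
    moduleLength R (R ⧸ I ^ (n + 1)) = (L : ℕ∞) ∧
    (L : ℤ) = ∑ i ∈ Finset.range (d + 1),
      (-1 : ℤ) ^ i * e i * ((n + d - i).choose (d - i) : ℤ)

/-- The index of reducibility `𝒩(q;R) = ℓ_R((q :_R 𝔪)/q)`. -/
def indexOfReducibility (q : Ideal R) : WithBot ℕ∞ :=
  moduleLength R
    (↥(q.colon (maximalIdeal R)) ⧸ (Submodule.comap (q.colon (maximalIdeal R)).subtype q))

/-- `R` is unmixed of dimension `d`: `dim (R̂/P) = d` for every associated prime `P`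
of the `𝔪`-adic completion `R̂` of `R`. -/
def IsUnmixed (d : ℕ) : Prop :=
  ∀ P ∈ associatedPrimes (AdicCompletion (maximalIdeal R) R) (AdicCompletion (maximalIdeal R) R),
    ringKrullDim ((AdicCompletion (maximalIdeal R) R) ⧸ P) = (d : WithBot ℕ∞)

/-- The depth of a local ring `A`, as the least `i` such that `Ext^i(k, A) ≠ 0`. -/
def extDepth (A : Type) [CommRing A] [IsLocalRing A] : ℕ∞ :=
  sInf {n : ℕ∞ | ∃ m : ℕ, n = (m : ℕ∞) ∧
    Nontrivial (((Ext A (ModuleCat A) m).obj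
      (Opposite.op (ModuleCat.of A (ResidueField A)))).obj (ModuleCat.of A A))}

/-- A local ring is Cohen–Macaulay if its depth equals its Krull dimension. -/
def IsCohenMacaulay (A : Type) [CommRing A] [IsLocalRing A] : Prop :=
  (extDepth A : WithBot ℕ∞) = ringKrullDim A

/-- The Cohen–Macaulay type `r(R) = ℓ_R(Ext^d_R(R/𝔪, R))`. -/
def cmType (d : ℕ) : WithBot ℕ∞ :=
  moduleLength R (((Ext R (ModuleCat R) d).obj
      (Opposite.op (ModuleCat.of R (R ⧸ maximalIdeal R)))).obj (ModuleCat.of R R))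

/-- `f` is the sequence of coefficients of the polynomial that agrees with
`n ↦ ℓ((Iⁿ :_R 𝔪)/Iⁿ)` for all large `n`; `f 0` is the irreducible multiplicity `f₀(I)`. -/
def IsIrrCoeffs (d : ℕ) (I : Ideal R) (f : ℕ → ℤ) : Prop :=
  ∃ N : ℕ, ∀ n ≥ N, ∃ L : ℕ,
    indexOfReducibility R (I ^ n) = (L : ℕ∞) ∧
    (L : ℤ) = ∑ i ∈ Finset.range d,
      (-1 : ℤ) ^ i * f i * ((n + (d - 1) - i).choose (d - 1 - i) : ℤ)

/-- `R` is a generalized Cohen–Macaulay ring of dimension `d`: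
the local cohomology modules `H^i_𝔪(R)` have finite length for all `i < d`. -/
def IsGeneralizedCM (d : ℕ) : Prop :=
  ∀ i < d, ∃ L : ℕ,
    moduleLength R ↥((localCohomology (maximalIdeal R) i).obj (ModuleCat.of R R)) = (L : ℕ∞)

/-- `r_i(R) = dim_k ((0) :_{H^i_𝔪(R)} 𝔪)`, the length of the socle of the `i`-th
local cohomology module of `R`. -/
def socLocalCohomology (i : ℕ) : WithBot ℕ∞ :=
  moduleLength R
    ↥(Submodule.torsionBySet R ↥((localCohomology (maximalIdeal R) i).obj (ModuleCat.of R R))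
      (maximalIdeal R : Set R))

/-- A system of parameters `x₁, …, x_d` is standard if
`𝔮·H^i_𝔪(R/(x₁,…,x_j)R) = 0` for all `i + j < d`, where `𝔮 = (x₁,…,x_d)`. -/
def IsStandardSOP (d : ℕ) (x : Fin d → R) : Prop :=
  (Ideal.span (Set.range x)).radical = maximalIdeal R ∧
  ∀ i j : ℕ, i + j < d →
    ∀ a ∈ Ideal.span (Set.range x),
      ∀ v : ((localCohomology (maximalIdeal R) i).obj
        (ModuleCat.of R (R ⧸ Ideal.span (x '' {k : Fin d | (k : ℕ) < j})))), a • v = 0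

/-- `R` is a regular local ring of dimension `d`: `𝔪` is generated by `d` elements. -/
def IsRegularLocal (d : ℕ) : Prop :=
  ∃ x : Fin d → R, maximalIdeal R = Ideal.span (Set.range x)

/-- `R` is Gorenstein: `R` is Cohen–Macaulay of Cohen–Macaulay type `r(R) = 1`. -/
def IsGorenstein (d : ℕ) : Prop :=
  IsCohenMacaulay R ∧ cmType R d = 1

noncomputable section LeftDerivedSequence

open Limits

variable {C D : Type*} [Category* C] [Category* D] [Abelian C] [Abelian D]
  {F G H : C ⥤ D} [F.Additive] [G.Additive] [H.Additive] (α : F ⟶ G) (β : G ⟶ H)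

/-- The short complex of chain complexes obtained by applying three functors to a resolution. -/
def leftDerivedShortComplex (w : α ≫ β = 0) {X : C} (P : ProjectiveResolution X) :
    ShortComplex (HomologicalComplex D (ComplexShape.down ℕ)) :=
  ShortComplex.mk ((NatTrans.mapHomologicalComplex α _).app P.complex)
    ((NatTrans.mapHomologicalComplex β _).app P.complex) (by
      ext n
      exact congr_app w (P.complex.X n))

lemma leftDerivedShortComplex_shortExact (w : α ≫ β = 0)
    (h : ∀ X : C, Projective X →
      (ShortComplex.mk (α.app X) (β.app X) (by rw [← NatTrans.comp_app, w]; rfl)).ShortExact)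
    {X : C} (P : ProjectiveResolution X) : (leftDerivedShortComplex α β w P).ShortExact := by
  apply HomologicalComplex.shortExact_of_degreewise_shortExact
  intro n
  exact h (P.complex.X n) (P.projective n)

lemma exists_homology_connecting (w : α ≫ β = 0)
    (h : ∀ X : C, Projective X →
      (ShortComplex.mk (α.app X) (β.app X) (by rw [← NatTrans.comp_app, w]; rfl)).ShortExact)
    (n : ℕ) :
    ∃ δ : ∀ {X : C} (P : ProjectiveResolution X),
      (HomologicalComplex.homologyFunctor D _ (n + 1)).obj
        ((H.mapHomologicalComplex _).obj P.complex) ⟶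
      (HomologicalComplex.homologyFunctor D _ n).obj ((F.mapHomologicalComplex _).obj P.complex),
      (∀ {X Y : C} (P : ProjectiveResolution X) (Q : ProjectiveResolution Y)
        (φ : P.complex ⟶ Q.complex),
        (H.mapHomologicalComplex _ ⋙ HomologicalComplex.homologyFunctor D _ (n + 1)).map φ ≫ δ Q =
        δ P ≫ (F.mapHomologicalComplex _ ⋙ HomologicalComplex.homologyFunctor D _ n).map φ) ∧
      (∀ {X : C} (P : ProjectiveResolution X),
        ∃ w₁ : (HomologicalComplex.homologyFunctor D _ (n + 1)).map
          ((NatTrans.mapHomologicalComplex β _).app P.complex) ≫ δ P = 0,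
        (ShortComplex.mk _ _ w₁).Exact) ∧
      (∀ {X : C} (P : ProjectiveResolution X),
        ∃ w₁ : δ P ≫ (HomologicalComplex.homologyFunctor D _ n).map
          ((NatTrans.mapHomologicalComplex α _).app P.complex) = 0,
        (ShortComplex.mk _ _ w₁).Exact) := by
  have hS := fun {X : C} (P : ProjectiveResolution X) =>
    leftDerivedShortComplex_shortExact α β w h P
  refine ⟨fun P => (hS P).δ (n + 1) n rfl, ?_, fun P => ⟨(hS P).comp_δ (n + 1) n rfl,
    (hS P).homology_exact₃ (n + 1) n rfl⟩, fun P => ⟨(hS P).δ_comp (n + 1) n rfl,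
    (hS P).homology_exact₁ (n + 1) n rfl⟩⟩
  intro X Y P Q φ
  let φ' : leftDerivedShortComplex α β w P ⟶ leftDerivedShortComplex α β w Q :=
      { τ₁ := (F.mapHomologicalComplex _).map φ
        τ₂ := (G.mapHomologicalComplex _).map φ
        τ₃ := (H.mapHomologicalComplex _).map φ
        comm₁₂ := NatTrans.naturality (NatTrans.mapHomologicalComplex α _) φ
        comm₂₃ := NatTrans.naturality (NatTrans.mapHomologicalComplex β _) φ }
  exact (HomologicalComplex.HomologySequence.δ_naturality φ' (hS P) (hS Q) (n + 1) n rfl).symm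

variable [EnoughProjectives C]

lemma exists_leftDerived_connecting (w : α ≫ β = 0)
    (h : ∀ X : C, Projective X →
      (ShortComplex.mk (α.app X) (β.app X) (by rw [← NatTrans.comp_app, w]; rfl)).ShortExact)
    (n : ℕ) :
    ∃ δ : H.leftDerived (n + 1) ⟶ F.leftDerived n,
      (∀ X, ∃ w₁ : (NatTrans.leftDerived β (n + 1)).app X ≫ δ.app X = 0,
        (ShortComplex.mk _ _ w₁).Exact) ∧
      (∀ X, ∃ w₂ : δ.app X ≫ (NatTrans.leftDerived α n).app X = 0,
        (ShortComplex.mk _ _ w₂).Exact) := by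
  obtain ⟨d, nat, ex₃, ex₁⟩ := exists_homology_connecting α β w h n
  let P := fun X : C => projectiveResolution X
  refine ⟨{
    app := fun X => ((P X).isoLeftDerivedObj H (n + 1)).hom ≫ d (P X) ≫
        ((P X).isoLeftDerivedObj F n).inv
    naturality := ?_ }, ?_, ?_⟩
  · intro X Y f
    have hl : (ProjectiveResolution.lift f (P X) (P Y)).f 0 ≫ (P Y).π.f 0 = (P X).π.f 0 ≫ f :=
      ProjectiveResolution.lift_commutes_zero f (P X) (P Y)
    rw [ProjectiveResolution.isoLeftDerivedObj_hom_naturality_assoc f (P X) (P Y) _ hl,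
      Category.assoc, Category.assoc,
      ProjectiveResolution.isoLeftDerivedObj_inv_naturality f (P X) (P Y) _ hl,
      reassoc_of% nat]
    rfl
  · intro X
    obtain ⟨w₁, ex⟩ := ex₃ (P X)
    have w₁' : (NatTrans.leftDerived β (n + 1)).app X ≫
        ((P X).isoLeftDerivedObj H (n + 1)).hom ≫ d (P X) ≫
        ((P X).isoLeftDerivedObj F n).inv = 0 := by
      rw [(P X).leftDerived_app_eq β (n + 1)]
      simp only [Category.assoc, Iso.inv_hom_id_assoc]
      rw [reassoc_of% w₁]
      simp only [zero_comp, comp_zero]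
    refine ⟨w₁', (ShortComplex.exact_iff_of_iso (ShortComplex.isoMk
      ((P X).isoLeftDerivedObj G (n + 1)) ((P X).isoLeftDerivedObj H (n + 1))
      ((P X).isoLeftDerivedObj F n) ?_ ?_)).2 ex⟩
    · dsimp only
      rw [(P X).leftDerived_app_eq β (n + 1)]
      simp only [Category.assoc, Iso.inv_hom_id, Category.comp_id]
    · simp only [Category.assoc, Iso.inv_hom_id, Category.comp_id]
  · intro X
    obtain ⟨w₁, ex⟩ := ex₁ (P X)
    have w₁' : (((P X).isoLeftDerivedObj H (n + 1)).hom ≫ d (P X) ≫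
        ((P X).isoLeftDerivedObj F n).inv) ≫ (NatTrans.leftDerived α n).app X = 0 := by
      rw [(P X).leftDerived_app_eq α n]
      simp only [Category.assoc, Iso.inv_hom_id_assoc]
      rw [reassoc_of% w₁]
      simp only [zero_comp, comp_zero]
    refine ⟨w₁', (ShortComplex.exact_iff_of_iso (ShortComplex.isoMk
      ((P X).isoLeftDerivedObj H (n + 1)) ((P X).isoLeftDerivedObj F n)
      ((P X).isoLeftDerivedObj G n) ?_ ?_)).2 ex⟩
    · simp only [Category.assoc, Iso.inv_hom_id, Category.comp_id]
    · dsimp only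
      rw [(P X).leftDerived_app_eq α n]
      simp only [Category.assoc, Iso.inv_hom_id, Category.comp_id]

lemma leftDerived_exact_middle (w : α ≫ β = 0)
    (h : ∀ X : C, Projective X →
      (ShortComplex.mk (α.app X) (β.app X) (by rw [← NatTrans.comp_app, w]; rfl)).ShortExact)
    (n : ℕ) (X : C) :
    ∃ w' : (NatTrans.leftDerived α n).app X ≫ (NatTrans.leftDerived β n).app X = 0,
        (ShortComplex.mk _ _ w').Exact := by
  let P := projectiveResolution X
  have hS := leftDerivedShortComplex_shortExact α β w h P
  have w₀ : (HomologicalComplex.homologyFunctor D _ n).map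
      ((NatTrans.mapHomologicalComplex α _).app P.complex) ≫
      (HomologicalComplex.homologyFunctor D _ n).map
      ((NatTrans.mapHomologicalComplex β _).app P.complex) = 0 :=
    (ShortComplex.map (leftDerivedShortComplex α β w P)
      (HomologicalComplex.homologyFunctor D _ n)).zero
  have ex : (ShortComplex.mk _ _ w₀).Exact := hS.homology_exact₂ n
  have w₁ : (NatTrans.leftDerived α n).app X ≫ (NatTrans.leftDerived β n).app X = 0 := by
    rw [P.leftDerived_app_eq α n, P.leftDerived_app_eq β n]
    simp only [Category.assoc, Iso.inv_hom_id_assoc]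
    rw [reassoc_of% w₀]
    simp only [zero_comp, comp_zero]
  refine ⟨w₁, (ShortComplex.exact_iff_of_iso (ShortComplex.isoMk
    (P.isoLeftDerivedObj F n) (P.isoLeftDerivedObj G n) (P.isoLeftDerivedObj H n) ?_ ?_)).2 ex⟩
  · dsimp only
    rw [P.leftDerived_app_eq α n]
    simp only [Category.assoc, Iso.inv_hom_id, Category.comp_id]
  · dsimp only
    rw [P.leftDerived_app_eq β n]
    simp only [Category.assoc, Iso.inv_hom_id, Category.comp_id]

end LeftDerivedSequence

noncomputable section LeftDerivedNaturality

open Limits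

variable {C D : Type*} [Category* C] [Category* D] [Abelian C] [Abelian D]

lemma homologyMap_eq_of_natural_endomorphism (η : 𝟭 D ⟶ 𝟭 D) {ι : Type*} {c : ComplexShape ι}
    (K : HomologicalComplex D c) (φ : K ⟶ K) (hφ : ∀ i, φ.f i = η.app (K.X i)) (i : ι) :
    HomologicalComplex.homologyMap φ i = η.app (K.homology i) := by
  rw [← cancel_epi (K.homologyπ i), HomologicalComplex.homologyπ_naturality]
  have h1 : HomologicalComplex.cyclesMap φ i = η.app (K.cycles i) := by
    rw [← cancel_mono (K.iCycles i), HomologicalComplex.cyclesMap_i, hφ]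
    exact η.naturality (K.iCycles i)
  rw [h1]
  exact (η.naturality (K.homologyπ i)).symm

lemma leftDerived_app_eq_of_natural_endomorphism [EnoughProjectives C] {F : C ⥤ D} [F.Additive]
    (η : 𝟭 D ⟶ 𝟭 D) (α : F ⟶ F) (h : ∀ X, α.app X = η.app (F.obj X)) (n : ℕ) (X : C) :
    (NatTrans.leftDerived α n).app X = η.app ((F.leftDerived n).obj X) := by
  let P := projectiveResolution X
  have h1 : (HomologicalComplex.homologyFunctor D (ComplexShape.down ℕ) n).map
      ((NatTrans.mapHomologicalComplex α _).app P.complex) =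
      η.app ((HomologicalComplex.homologyFunctor D (ComplexShape.down ℕ) n).obj
        ((F.mapHomologicalComplex _).obj P.complex)) :=
    homologyMap_eq_of_natural_endomorphism η _ _ (fun i => h _) n
  rw [P.leftDerived_app_eq α n, h1, ← Category.assoc]
  have := η.naturality (P.isoLeftDerivedObj F n).hom
  simp only [Functor.id_map] at this
  rw [this, Category.assoc, Iso.hom_inv_id, Category.comp_id]

lemma isZero_leftDerived_succ_of_exact [EnoughProjectives C] (F : C ⥤ D) [F.Additive]
    [F.PreservesHomology] (n : ℕ) (X : C) : IsZero ((F.leftDerived (n + 1)).obj X) := by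
  let P := projectiveResolution X
  refine IsZero.of_iso ?_ (P.isoLeftDerivedObj F (n + 1))
  have h := (P.complex_exactAt_succ n).map F
  exact (HomologicalComplex.exactAt_iff_isZero_homology _ _).1 h

end LeftDerivedNaturality

noncomputable section ExtSequence

variable {R : Type} [CommRing R]

lemma linearYoneda_rightOp_shortExact {S : ShortComplex (ModuleCat.{0} R)} (hS : S.ShortExact)
    (X : ModuleCat.{0} R) (hX : Projective X)
    (w : ((linearYoneda R _).map S.g).rightOp.app X ≫
      ((linearYoneda R _).map S.f).rightOp.app X = 0) :
    (ShortComplex.mk _ _ w).ShortExact := by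
  have := hS.mono_f
  have := hS.epi_g
  have w' : ((linearYoneda R _).map S.f).app (Opposite.op X) ≫
      ((linearYoneda R _).map S.g).app (Opposite.op X) = 0 := congrArg Quiver.Hom.unop w
  have hm : Mono (((linearYoneda R _).map S.f).app (Opposite.op X)) := by
    rw [ModuleCat.mono_iff_injective]
    intro (φ : X ⟶ S.X₁) (ψ : X ⟶ S.X₁) (h : φ ≫ S.f = ψ ≫ S.f)
    exact (cancel_mono S.f).1 h
  have he : Epi (((linearYoneda R _).map S.g).app (Opposite.op X)) := by
    rw [ModuleCat.epi_iff_surjective]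
    intro (φ : X ⟶ S.X₃)
    exact ⟨Projective.factorThru φ S.g, Projective.factorThru_comp φ S.g⟩
  have hex : (ShortComplex.mk _ _ w').Exact := by
    rw [ShortComplex.ShortExact.moduleCat_exact_iff_function_exact]
    intro (φ : X ⟶ S.X₂)
    refine ⟨fun (h : φ ≫ S.g = 0) => ⟨hS.exact.lift φ h, hS.exact.lift_f φ h⟩, ?_⟩
    rintro ⟨ψ, rfl⟩
    have (ψ : X ⟶ S.X₁) : (ψ ≫ S.f) ≫ S.g = 0 := by simp
    exact this ψ
  have key : (ShortComplex.mk _ _ w').ShortExact :=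
    { exact := hex, mono_f := hm, epi_g := he }
  exact key.op

lemma ext_exact {S : ShortComplex (ModuleCat.{0} R)} (hS : S.ShortExact) (n : ℕ)
    (X : ModuleCat.{0} R) :
    Function.Exact ((((Ext R (ModuleCat.{0} R) n).obj (Opposite.op X)).map S.f).hom)
      ((((Ext R (ModuleCat.{0} R) n).obj (Opposite.op X)).map S.g).hom) := by
  obtain ⟨w, ex⟩ := leftDerived_exact_middle ((linearYoneda R (ModuleCat.{0} R)).map S.g).rightOp
    ((linearYoneda R (ModuleCat.{0} R)).map S.f).rightOp
    (by rw [← NatTrans.rightOp_comp, ← Functor.map_comp, S.zero, Functor.map_zero]; rfl)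
    (fun X hX => linearYoneda_rightOp_shortExact hS X hX _) n X
  exact (ShortComplex.ShortExact.moduleCat_exact_iff_function_exact _).1 ex.unop

lemma exists_ext_connecting {S : ShortComplex (ModuleCat.{0} R)} (hS : S.ShortExact) (n : ℕ) :
    ∃ δ : (Ext R (ModuleCat.{0} R) n).flip.obj S.X₃ ⟶ (Ext R (ModuleCat.{0} R) (n + 1)).flip.obj S.X₁,
      ∀ X, Function.Exact ((((Ext R (ModuleCat.{0} R) n).obj X).map S.g).hom) (δ.app X).hom ∧
       Function.Exact (δ.app X).hom ((((Ext R (ModuleCat.{0} R) (n + 1)).obj X).map S.f).hom) := by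
  obtain ⟨δ, h₃, h₁⟩ := exists_leftDerived_connecting ((linearYoneda R (ModuleCat.{0} R)).map S.g).rightOp
    ((linearYoneda R (ModuleCat.{0} R)).map S.f).rightOp
    (by rw [← NatTrans.rightOp_comp, ← Functor.map_comp, S.zero, Functor.map_zero]; rfl)
    (fun X hX => linearYoneda_rightOp_shortExact hS X hX _) n
  refine ⟨NatTrans.leftOp δ, fun X => ⟨?_, ?_⟩⟩
  · obtain ⟨w, ex⟩ := h₁ X.unop
    exact (ShortComplex.ShortExact.moduleCat_exact_iff_function_exact _).1 ex.unop
  · obtain ⟨w, ex⟩ := h₃ X.unop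
    exact (ShortComplex.ShortExact.moduleCat_exact_iff_function_exact _).1 ex.unop

/-- Multiplication by `y`, as a natural endomorphism of the identity on the opposite category. -/
def opSMulNatTrans (y : R) : 𝟭 (ModuleCat.{0} R)ᵒᵖ ⟶ 𝟭 (ModuleCat.{0} R)ᵒᵖ where
  app M := (y • 𝟙 M.unop).op
  naturality M N f := by
    apply Quiver.Hom.unop_inj
    simp

lemma ext_map_smul (n : ℕ) (X : (ModuleCat.{0} R)ᵒᵖ) (M : ModuleCat.{0} R) (y : R) :
    ((Ext R (ModuleCat.{0} R) n).obj X).map (y • 𝟙 M) =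
      y • 𝟙 (((Ext R (ModuleCat.{0} R) n).obj X).obj M) := by
  have := leftDerived_app_eq_of_natural_endomorphism (opSMulNatTrans y)
    ((linearYoneda R (ModuleCat.{0} R)).map (y • 𝟙 M)).rightOp (fun X => by
      apply Quiver.Hom.unop_inj
      ext (f : X ⟶ M)
      change f ≫ (y • 𝟙 M) = y • f
      simp) n X.unop
  exact congrArg Quiver.Hom.unop this

lemma isZero_ext_of_injective (n : ℕ) (X : (ModuleCat.{0} R)ᵒᵖ) (E : ModuleCat.{0} R) [Injective E] :
    Limits.IsZero (((Ext R (ModuleCat.{0} R) (n + 1)).obj X).obj E) := by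
  have : ((linearYoneda R (ModuleCat.{0} R)).obj E).rightOp.PreservesHomology := by
    apply Functor.preservesHomology_of_map_exact
    intro S hS
    have hw : ((linearYoneda R (ModuleCat.{0} R)).obj E).map S.g.op ≫
        ((linearYoneda R (ModuleCat.{0} R)).obj E).map S.f.op = 0 := by
      ext (φ : S.X₃ ⟶ E)
      change S.f ≫ S.g ≫ φ = 0
      simp
    have hex : (ShortComplex.mk _ _ hw).Exact := by
      rw [ShortComplex.ShortExact.moduleCat_exact_iff_function_exact]
      intro (φ : S.X₂ ⟶ E)
      refine ⟨fun (h : S.f ≫ φ = 0) => ⟨hS.descToInjective φ h, hS.comp_descToInjective φ h⟩, ?_⟩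
      rintro ⟨ψ, rfl⟩
      have (ψ : S.X₃ ⟶ E) : S.f ≫ S.g ≫ ψ = 0 := by simp
      exact this ψ
    exact hex.op
  exact (isZero_leftDerived_succ_of_exact ((linearYoneda R (ModuleCat.{0} R)).obj E).rightOp n X.unop).unop

end ExtSequence

noncomputable section ExtZero

open Limits

section
variable {C D : Type*} [Category* C] [Category* D] [Abelian C] [Abelian D]
  {F G : C ⥤ D} [F.Additive] [G.Additive] [EnoughProjectives C]

lemma leftDerived_comp_fromLeftDerivedZero (α : F ⟶ G) (X : C) :
    (NatTrans.leftDerived α 0).app X ≫ G.fromLeftDerivedZero.app X =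
      F.fromLeftDerivedZero.app X ≫ α.app X := by
  let P := projectiveResolution X
  rw [P.fromLeftDerivedZero_eq F, P.fromLeftDerivedZero_eq G, P.leftDerived_app_eq α 0]
  simp only [Category.assoc, Iso.inv_hom_id_assoc]
  congr 1
  have h1 : (HomologicalComplex.homologyFunctor D (ComplexShape.down ℕ) 0).map
        ((NatTrans.mapHomologicalComplex α (ComplexShape.down ℕ)).app P.complex) ≫
      (ChainComplex.isoHomologyι₀ ((G.mapHomologicalComplex _).obj P.complex)).hom =
      (ChainComplex.isoHomologyι₀ ((F.mapHomologicalComplex _).obj P.complex)).hom ≫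
      HomologicalComplex.opcyclesMap
        ((NatTrans.mapHomologicalComplex α (ComplexShape.down ℕ)).app P.complex) 0 :=
    HomologicalComplex.homologyι_naturality _ _
  have h2 : HomologicalComplex.opcyclesMap
        ((NatTrans.mapHomologicalComplex α (ComplexShape.down ℕ)).app P.complex) 0 ≫
        P.fromLeftDerivedZero' G = P.fromLeftDerivedZero' F ≫ α.app X := by
    rw [← cancel_epi (HomologicalComplex.pOpcycles _ _)]
    rw [HomologicalComplex.p_opcyclesMap_assoc,
      ProjectiveResolution.pOpcycles_comp_fromLeftDerivedZero',
      ProjectiveResolution.pOpcycles_comp_fromLeftDerivedZero'_assoc]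
    exact (α.naturality (P.π.f 0)).symm
  refine (Category.assoc _ _ _).symm.trans ((congrArg (· ≫ P.fromLeftDerivedZero' G) h1).trans ?_)
  exact (Category.assoc _ _ _).trans ((congrArg (_ ≫ ·) h2).trans (Category.assoc _ _ _).symm)

end

variable {R : Type} [CommRing R]

instance (M : ModuleCat.{0} R) :
    PreservesFiniteLimits ((linearYoneda R (ModuleCat.{0} R)).obj M) := by
  have : PreservesFiniteLimits ((linearYoneda R (ModuleCat.{0} R)).obj M ⋙ forget _) := by
    change PreservesFiniteLimits (yoneda.obj M)
    infer_instance
  exact preservesFiniteLimits_of_reflects_of_preserves _ (forget (ModuleCat R))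

instance (M : ModuleCat.{0} R) :
    PreservesFiniteColimits ((linearYoneda R (ModuleCat.{0} R)).obj M).rightOp :=
  preservesFiniteColimits_rightOp _

/-- `Hom` agrees with the zeroth `Ext`. -/
def extZeroEquiv (X : (ModuleCat.{0} R)ᵒᵖ) (M : ModuleCat.{0} R) :
    (X.unop ⟶ M) ≃ₗ[R] ((Ext R (ModuleCat.{0} R) 0).obj X).obj M :=
  (((linearYoneda R (ModuleCat.{0} R)).obj M).rightOp.leftDerivedZeroIsoSelf.app
    X.unop).unop.toLinearEquiv

lemma extZeroEquiv_naturality_left {X Y : (ModuleCat.{0} R)ᵒᵖ} (f : X ⟶ Y) (M : ModuleCat.{0} R)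
    (φ : X.unop ⟶ M) :
    (((Ext R (ModuleCat.{0} R) 0).map f).app M).hom (extZeroEquiv X M φ) =
      extZeroEquiv Y M (f.unop ≫ φ) := by
  have := ((linearYoneda R (ModuleCat.{0} R)).obj M).rightOp.fromLeftDerivedZero.naturality f.unop
  exact congrArg (fun t => t.unop.hom φ) this

lemma extZeroEquiv_naturality_right (X : (ModuleCat.{0} R)ᵒᵖ) {M N : ModuleCat.{0} R} (f : M ⟶ N)
    (φ : X.unop ⟶ M) :
    (((Ext R (ModuleCat.{0} R) 0).obj X).map f).hom (extZeroEquiv X M φ) =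
      extZeroEquiv X N (φ ≫ f) := by
  have := leftDerived_comp_fromLeftDerivedZero
    ((linearYoneda R (ModuleCat.{0} R)).map f).rightOp X.unop
  exact congrArg (fun t => t.unop.hom φ) this

end ExtZero

section LocalCohomologySequence

open Limits Opposite

variable {R : Type} [CommRing R]

abbrev extQuot (I : Ideal R) (i n : ℕ) (M : ModuleCat.{0} R) : ModuleCat.{0} R :=
  ((Ext R (ModuleCat.{0} R) i).obj (op (ModuleCat.of R (R ⧸ I ^ n)))).obj M

def quotPowMap (I : Ideal R) {n m : ℕ} (h : n ≤ m) :
    ModuleCat.of R (R ⧸ I ^ m) ⟶ ModuleCat.of R (R ⧸ I ^ n) :=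
  ModuleCat.ofHom (Submodule.mapQ _ _ LinearMap.id (Ideal.pow_le_pow_right h))

def extQuotMap (I : Ideal R) (i : ℕ) {n m : ℕ} (h : n ≤ m) (M : ModuleCat.{0} R) :
    extQuot I i n M →ₗ[R] extQuot I i m M :=
  (((Ext R (ModuleCat.{0} R) i).map (quotPowMap I h).op).app M).hom

def lcι (I : Ideal R) (i n : ℕ) (M : ModuleCat.{0} R) :
    extQuot I i n M →ₗ[R] (localCohomology I i).obj M :=
  ((colimit.ι (localCohomology.diagram (localCohomology.idealPowersDiagram I) i) (op (op n))).app M).hom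

lemma lcι_extQuotMap (I : Ideal R) (i : ℕ) {n m : ℕ} (h : n ≤ m) (M : ModuleCat.{0} R)
    (e : extQuot I i n M) : lcι I i m M (extQuotMap I i h M e) = lcι I i n M e := by
  have := colimit.w (localCohomology.diagram (localCohomology.idealPowersDiagram I) i)
    (homOfLE h).op.op
  exact congrArg (fun t : (localCohomology.diagram (localCohomology.idealPowersDiagram I) i).obj
    (op (op n)) ⟶ localCohomology I i => (t.app M).hom e) this

lemma lc_map_lcι (I : Ideal R) (i n : ℕ) {M N : ModuleCat.{0} R} (f : M ⟶ N)
    (e : extQuot I i n M) : ((localCohomology I i).map f).hom (lcι I i n M e) =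
      lcι I i n N ((((Ext R (ModuleCat.{0} R) i).obj (op (ModuleCat.of R (R ⧸ I ^ n)))).map f).hom e) := by
  have := (colimit.ι (localCohomology.diagram (localCohomology.idealPowersDiagram I) i) (op (op n))).naturality f
  exact (congrArg (fun t => t.hom e) this).symm

def lcIsColimit (I : Ideal R) (i : ℕ) (M : ModuleCat.{0} R) :=
  isColimitOfPreserves ((evaluation (ModuleCat.{0} R) (ModuleCat.{0} R)).obj M)
    (colimit.isColimit (localCohomology.diagram (localCohomology.idealPowersDiagram I) i))

lemma exists_lcι (I : Ideal R) (i : ℕ) (M : ModuleCat.{0} R) (z : (localCohomology I i).obj M) :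
    ∃ n e, lcι I i n M e = z := by
  obtain ⟨n, e, h⟩ := Concrete.isColimit_exists_rep _ (lcIsColimit I i M) z
  exact ⟨n.unop.unop, e, h⟩

lemma exists_extQuotMap_eq (I : Ideal R) (i n : ℕ) (M : ModuleCat.{0} R)
    (e e' : extQuot I i n M) (h : lcι I i n M e = lcι I i n M e') :
    ∃ m, ∃ h : n ≤ m, extQuotMap I i h M e = extQuotMap I i h M e' := by
  obtain ⟨m, f, g, hfg⟩ := Concrete.isColimit_exists_of_rep_eq _ (lcIsColimit I i M) (i := op (op n))
    (j := op (op n)) e e' h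
  obtain rfl : f = g := Subsingleton.elim _ _
  exact ⟨m.unop.unop, f.unop.unop.le, hfg⟩

lemma exists_extQuotMap_eq_zero (I : Ideal R) (i n : ℕ) (M : ModuleCat.{0} R)
    (e : extQuot I i n M) (h : lcι I i n M e = 0) : ∃ m, ∃ h : n ≤ m, extQuotMap I i h M e = 0 := by
  obtain ⟨m, h, h'⟩ := exists_extQuotMap_eq I i n M e 0 (by rw [h, map_zero])
  exact ⟨m, h, by rw [h', map_zero]⟩

lemma extQuotMap_naturality (I : Ideal R) (i : ℕ) {n m : ℕ} (h : n ≤ m) {M N : ModuleCat.{0} R}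
    (f : M ⟶ N) (e : extQuot I i n M) :
    extQuotMap I i h N ((((Ext R (ModuleCat.{0} R) i).obj
      (op (ModuleCat.of R (R ⧸ I ^ n)))).map f).hom e) =
    (((Ext R (ModuleCat.{0} R) i).obj (op (ModuleCat.of R (R ⧸ I ^ m)))).map f).hom
      (extQuotMap I i h M e) :=
  congrArg (fun t => t.hom e) (((Ext R (ModuleCat.{0} R) i).map (quotPowMap I h).op).naturality f)

lemma lc_exact (I : Ideal R) (i : ℕ) {S : ShortComplex (ModuleCat.{0} R)} (hS : S.ShortExact) :
    Function.Exact ((localCohomology I i).map S.f).hom ((localCohomology I i).map S.g).hom := by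
  intro z
  constructor
  · intro hz
    obtain ⟨n, e, rfl⟩ := exists_lcι I i _ z
    rw [lc_map_lcι] at hz
    obtain ⟨m, h, hm⟩ := exists_extQuotMap_eq_zero I i n _ _ hz
    rw [extQuotMap_naturality] at hm
    obtain ⟨e', he'⟩ := (ext_exact hS i _ _).1 hm
    refine ⟨lcι I i m _ e', ?_⟩
    rw [lc_map_lcι, he', lcι_extQuotMap]
  · rintro ⟨y, rfl⟩
    obtain ⟨n, e, rfl⟩ := exists_lcι I i _ y
    rw [lc_map_lcι, lc_map_lcι, (ext_exact hS i _).apply_apply_eq_zero, map_zero]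

lemma exists_lc_connecting (I : Ideal R) (i : ℕ) {S : ShortComplex (ModuleCat.{0} R)}
    (hS : S.ShortExact) :
    ∃ δ : (localCohomology I i).obj S.X₃ →ₗ[R] (localCohomology I (i + 1)).obj S.X₁,
      Function.Exact ((localCohomology I i).map S.g).hom δ ∧
      Function.Exact δ ((localCohomology I (i + 1)).map S.f).hom := by
  obtain ⟨d, hd⟩ := exists_ext_connecting hS i
  let dq : ∀ n, extQuot I i n S.X₃ →ₗ[R] extQuot I (i + 1) n S.X₁ := fun n => (d.app _).hom
  have dq_nat : ∀ {n m : ℕ} (h : n ≤ m) (e : extQuot I i n S.X₃),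
      dq m (extQuotMap I i h _ e) = extQuotMap I (i + 1) h _ (dq n e) := fun h e =>
    congrArg (fun t => t.hom e) (d.naturality (quotPowMap I h).op)
  obtain ⟨δ, hδ⟩ : ∃ δ : (localCohomology I i).obj S.X₃ →ₗ[R] (localCohomology I (i + 1)).obj S.X₁,
      ∀ n e, δ (lcι I i n _ e) = lcι I (i + 1) n _ (dq n e) := by
    let c : Cocone (localCohomology.diagram (localCohomology.idealPowersDiagram I) i ⋙
        (evaluation (ModuleCat.{0} R) (ModuleCat.{0} R)).obj S.X₃) :=
      { pt := (localCohomology I (i + 1)).obj S.X₁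
        ι :=
        { app := fun n => ModuleCat.ofHom (lcι I (i + 1) n.unop.unop _ ∘ₗ dq n.unop.unop)
          naturality := by
            intro n m f
            ext (e : extQuot I i n.unop.unop S.X₃)
            change lcι I (i + 1) m.unop.unop _ (dq m.unop.unop (extQuotMap I i f.unop.unop.le _ e)) =
              lcι I (i + 1) n.unop.unop _ (dq n.unop.unop e)
            rw [dq_nat, lcι_extQuotMap] } }
    refine ⟨((lcIsColimit I i S.X₃).desc c).hom, fun n e => ?_⟩
    exact congrArg (fun t => t.hom e) ((lcIsColimit I i S.X₃).fac c (op (op n)))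
  refine ⟨δ, ?_, ?_⟩
  · intro z
    constructor
    · intro hz
      obtain ⟨n, e, rfl⟩ := exists_lcι I i _ z
      rw [hδ] at hz
      obtain ⟨m, h, hm⟩ := exists_extQuotMap_eq_zero I _ n _ _ hz
      rw [← dq_nat] at hm
      obtain ⟨e', he'⟩ := ((hd _).1 _).1 hm
      refine ⟨lcι I i m _ e', ?_⟩
      rw [lc_map_lcι, he', lcι_extQuotMap]
    · rintro ⟨y, rfl⟩
      obtain ⟨n, e, rfl⟩ := exists_lcι I i _ y
      rw [lc_map_lcι, hδ]
      exact (congrArg _ ((hd _).1.apply_apply_eq_zero e)).trans (map_zero _)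
  · intro z
    constructor
    · intro hz
      obtain ⟨n, e, rfl⟩ := exists_lcι I (i + 1) _ z
      rw [lc_map_lcι] at hz
      obtain ⟨m, h, hm⟩ := exists_extQuotMap_eq_zero I _ n _ _ hz
      rw [extQuotMap_naturality] at hm
      obtain ⟨e', he'⟩ := ((hd _).2 _).1 hm
      refine ⟨lcι I i m _ e', ?_⟩
      rw [hδ, ← lcι_extQuotMap I (i + 1) h]
      exact congrArg _ he'
    · rintro ⟨y, rfl⟩
      obtain ⟨n, e, rfl⟩ := exists_lcι I i _ y
      rw [hδ, lc_map_lcι]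
      exact (congrArg _ ((hd _).2.apply_apply_eq_zero e)).trans (map_zero _)

lemma lc_map_smul (I : Ideal R) (i : ℕ) (M : ModuleCat.{0} R) (y : R)
    (z : (localCohomology I i).obj M) :
    ((localCohomology I i).map (y • 𝟙 M)).hom z = y • z := by
  obtain ⟨n, e, rfl⟩ := exists_lcι I i _ z
  rw [lc_map_lcι, ext_map_smul, ← map_smul]
  rfl

lemma lc_injective_eq_zero (I : Ideal R) (i : ℕ) (E : ModuleCat.{0} R) [Injective E]
    (z : (localCohomology I (i + 1)).obj E) : z = 0 := by
  obtain ⟨n, e, rfl⟩ := exists_lcι I (i + 1) _ z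
  have := ModuleCat.subsingleton_of_isZero
    (isZero_ext_of_injective i (op (ModuleCat.of R (R ⧸ I ^ n))) E)
  rw [Subsingleton.elim e 0, map_zero]

/-- The submodule of elements killed by a power of `I`. -/
def powTorsion (I : Ideal R) (M : Type) [AddCommGroup M] [Module R M] : Submodule R M where
  carrier := {m | ∃ n, ∀ a ∈ I ^ n, a • m = 0}
  zero_mem' := ⟨0, by simp⟩
  add_mem' := by
    rintro a b ⟨n, hn⟩ ⟨m, hm⟩
    refine ⟨n + m, fun r hr => ?_⟩
    rw [smul_add, hn r (Ideal.pow_le_pow_right (by omega) hr),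
      hm r (Ideal.pow_le_pow_right (by omega) hr), add_zero]
  smul_mem' := by
    rintro r a ⟨n, hn⟩
    exact ⟨n, fun s hs => by rw [smul_comm, hn s hs, smul_zero]⟩

lemma mem_powTorsion {I : Ideal R} {M : Type} [AddCommGroup M] [Module R M] {m : M} :
    m ∈ powTorsion I M ↔ ∃ n, ∀ a ∈ I ^ n, a • m = 0 := Iff.rfl

/-- The element of the zeroth local cohomology given by an element killed by `I ^ n`. -/
def lcZeroOfHom (I : Ideal R) (n : ℕ) (M : ModuleCat.{0} R) (φ : ModuleCat.of R (R ⧸ I ^ n) ⟶ M) :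
    (localCohomology I 0).obj M :=
  lcι I 0 n M (extZeroEquiv (op _) M φ)

lemma lcZeroOfHom_quotPowMap (I : Ideal R) {n m : ℕ} (h : n ≤ m) (M : ModuleCat.{0} R)
    (φ : ModuleCat.of R (R ⧸ I ^ n) ⟶ M) :
    lcZeroOfHom I m M (quotPowMap I h ≫ φ) = lcZeroOfHom I n M φ := by
  rw [lcZeroOfHom, lcZeroOfHom, ← lcι_extQuotMap I 0 h]
  exact congrArg _ (extZeroEquiv_naturality_left (quotPowMap I h).op M φ).symm

lemma exists_lcZeroOfHom (I : Ideal R) (M : ModuleCat.{0} R) (z : (localCohomology I 0).obj M) :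
    ∃ n φ, lcZeroOfHom I n M φ = z := by
  obtain ⟨n, e, rfl⟩ := exists_lcι I 0 _ z
  exact ⟨n, (extZeroEquiv (op _) M).symm e, congrArg _ ((extZeroEquiv (op _) M).apply_symm_apply e)⟩

lemma lcZeroOfHom_add (I : Ideal R) (n : ℕ) (M : ModuleCat.{0} R)
    (φ ψ : ModuleCat.of R (R ⧸ I ^ n) ⟶ M) :
    lcZeroOfHom I n M (φ + ψ) = lcZeroOfHom I n M φ + lcZeroOfHom I n M ψ := by
  rw [lcZeroOfHom, map_add]; exact map_add (lcι I 0 n M) _ _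

lemma lcZeroOfHom_smul (I : Ideal R) (n : ℕ) (M : ModuleCat.{0} R) (r : R)
    (φ : ModuleCat.of R (R ⧸ I ^ n) ⟶ M) :
    lcZeroOfHom I n M (r • φ) = r • lcZeroOfHom I n M φ := by
  rw [lcZeroOfHom, map_smul]; exact map_smul (lcι I 0 n M) _ _

lemma lc_map_lcZeroOfHom (I : Ideal R) (n : ℕ) {M N : ModuleCat.{0} R} (f : M ⟶ N)
    (φ : ModuleCat.of R (R ⧸ I ^ n) ⟶ M) :
    ((localCohomology I 0).map f).hom (lcZeroOfHom I n M φ) = lcZeroOfHom I n N (φ ≫ f) := by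
  rw [lcZeroOfHom, lc_map_lcι, lcZeroOfHom]
  exact congrArg _ (extZeroEquiv_naturality_right (op _) f φ)

lemma lcZeroOfHom_eq_zero (I : Ideal R) (n : ℕ) (M : ModuleCat.{0} R)
    (φ : ModuleCat.of R (R ⧸ I ^ n) ⟶ M) (h : lcZeroOfHom I n M φ = 0) : φ = 0 := by
  obtain ⟨m, hm, h'⟩ := exists_extQuotMap_eq_zero I 0 n M _ h
  have h2 := (extZeroEquiv_naturality_left (quotPowMap I hm).op M φ).symm.trans h'
  have h3 : quotPowMap I hm ≫ φ = 0 := (extZeroEquiv (op _) M).map_eq_zero_iff.1 h2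
  have : Epi (quotPowMap I hm) := by
    rw [ModuleCat.epi_iff_surjective]
    intro z
    obtain ⟨r, rfl⟩ := Submodule.Quotient.mk_surjective _ z
    exact ⟨Submodule.Quotient.mk r, rfl⟩
  rw [← cancel_epi (quotPowMap I hm), h3, comp_zero]

end LocalCohomologySequence

section LocalCohomologyZero

open Limits Opposite

variable {R : Type} [CommRing R]

lemma lcZeroOfHom_apply_one_eq (I : Ideal R) (M : ModuleCat.{0} R) {n m : ℕ}
    (φ : ModuleCat.of R (R ⧸ I ^ n) ⟶ M) (ψ : ModuleCat.of R (R ⧸ I ^ m) ⟶ M)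
    (h : lcZeroOfHom I n M φ = lcZeroOfHom I m M ψ) :
    φ.hom (Submodule.Quotient.mk 1) = ψ.hom (Submodule.Quotient.mk 1) := by
  have h1 := lcZeroOfHom_quotPowMap I (le_max_left n m) M φ
  have h2 := lcZeroOfHom_quotPowMap I (le_max_right n m) M ψ
  have h3 : lcZeroOfHom I (max n m) M (quotPowMap I (le_max_left n m) ≫ φ +
      (-1 : R) • (quotPowMap I (le_max_right n m) ≫ ψ)) = 0 := by
    rw [lcZeroOfHom_add, lcZeroOfHom_smul, h1, h2, h]
    simp
  have h4 := congrArg (fun t => t.hom (Submodule.Quotient.mk 1)) (lcZeroOfHom_eq_zero _ _ _ _ h3)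
  have h5 : φ.hom (Submodule.Quotient.mk 1) + (-1 : R) • ψ.hom (Submodule.Quotient.mk 1) = 0 := h4
  rwa [neg_one_smul, ← sub_eq_add_neg, sub_eq_zero] at h5

lemma exists_lcZeroEval (I : Ideal R) (M : ModuleCat.{0} R) :
    ∃ ev : (localCohomology I 0).obj M →ₗ[R] M,
      ∀ n φ, ev (lcZeroOfHom I n M φ) = φ.hom (Submodule.Quotient.mk 1) := by
  choose n φ h using exists_lcZeroOfHom I M
  have key : ∀ z k (ψ : ModuleCat.of R (R ⧸ I ^ k) ⟶ M), lcZeroOfHom I k M ψ = z →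
      (φ z).hom (Submodule.Quotient.mk 1) = ψ.hom (Submodule.Quotient.mk 1) := fun z k ψ hψ =>
    lcZeroOfHom_apply_one_eq I M _ _ ((h z).trans hψ.symm)
  refine ⟨{ toFun := fun z => (φ z).hom (Submodule.Quotient.mk 1), map_add' := ?_,
            map_smul' := ?_ }, fun k ψ => key _ _ _ rfl⟩
  · intro z w
    rw [key (z + w) (max (n z) (n w)) (quotPowMap I (le_max_left _ _) ≫ φ z +
      quotPowMap I (le_max_right _ _) ≫ φ w) (by
        rw [lcZeroOfHom_add, lcZeroOfHom_quotPowMap, lcZeroOfHom_quotPowMap, h, h])]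
    rfl
  · intro r z
    rw [key (r • z) (n z) (r • φ z) (by rw [lcZeroOfHom_smul, h])]
    rfl

/-- Evaluation at `1` of an element of the zeroth local cohomology. -/
def lcZeroEval (I : Ideal R) (M : ModuleCat.{0} R) : (localCohomology I 0).obj M →ₗ[R] M :=
  (exists_lcZeroEval I M).choose

lemma lcZeroEval_lcZeroOfHom (I : Ideal R) (M : ModuleCat.{0} R) (n : ℕ)
    (φ : ModuleCat.of R (R ⧸ I ^ n) ⟶ M) :
    lcZeroEval I M (lcZeroOfHom I n M φ) = φ.hom (Submodule.Quotient.mk 1) :=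
  (exists_lcZeroEval I M).choose_spec n φ

lemma lcZeroEval_injective (I : Ideal R) (M : ModuleCat.{0} R) :
    Function.Injective (lcZeroEval I M) := by
  rw [injective_iff_map_eq_zero]
  intro z hz
  obtain ⟨n, φ, rfl⟩ := exists_lcZeroOfHom I M z
  rw [lcZeroEval_lcZeroOfHom] at hz
  have : φ = 0 := by
    apply ModuleCat.hom_ext
    apply LinearMap.ext
    intro z
    obtain ⟨r, rfl⟩ := Submodule.Quotient.mk_surjective _ z
    have h1 : (Submodule.Quotient.mk r : R ⧸ I ^ n) = r • Submodule.Quotient.mk 1 := by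
      rw [← Submodule.Quotient.mk_smul, smul_eq_mul, mul_one]
    rw [h1]
    refine (map_smul φ.hom r _).trans ?_
    rw [hz, smul_zero]
    rfl
  have h0 := lcZeroOfHom_smul I n M 0 φ
  rwa [zero_smul, zero_smul, ← this] at h0

lemma range_lcZeroEval (I : Ideal R) (M : ModuleCat.{0} R) :
    LinearMap.range (lcZeroEval I M) = powTorsion I M := by
  ext m
  rw [LinearMap.mem_range, mem_powTorsion]
  constructor
  · rintro ⟨z, rfl⟩
    obtain ⟨n, φ, rfl⟩ := exists_lcZeroOfHom I M z
    refine ⟨n, fun a ha => ?_⟩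
    rw [lcZeroEval_lcZeroOfHom]
    refine (map_smul φ.hom a _).symm.trans ?_
    have h1 : a • (Submodule.Quotient.mk 1 : R ⧸ I ^ n) = 0 := by
      rw [← Submodule.Quotient.mk_smul, smul_eq_mul, mul_one]
      exact (Submodule.Quotient.mk_eq_zero _).2 ha
    exact (congrArg φ.hom h1).trans (map_zero _)
  · rintro ⟨n, hn⟩
    let f : R ⧸ I ^ n →ₗ[R] M := Submodule.liftQ (I ^ n) (LinearMap.toSpanSingleton R M m)
      (fun a ha => LinearMap.mem_ker.2 (hn a ha))
    refine ⟨lcZeroOfHom I n M (ModuleCat.ofHom f), ?_⟩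
    rw [lcZeroEval_lcZeroOfHom]
    exact (Submodule.liftQ_apply _ _ _).trans (one_smul R m)

lemma lcZeroEval_map (I : Ideal R) {M N : ModuleCat.{0} R} (f : M ⟶ N)
    (z : (localCohomology I 0).obj M) :
    lcZeroEval I N (((localCohomology I 0).map f).hom z) = f.hom (lcZeroEval I M z) := by
  obtain ⟨n, φ, rfl⟩ := exists_lcZeroOfHom I M z
  rw [lc_map_lcZeroOfHom, lcZeroEval_lcZeroOfHom, lcZeroEval_lcZeroOfHom]
  rfl

/-- The zeroth local cohomology is the torsion submodule. -/
def lcZeroEquiv (I : Ideal R) (M : ModuleCat.{0} R) :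
    (localCohomology I 0).obj M ≃ₗ[R] powTorsion I M :=
  (LinearEquiv.ofInjective (lcZeroEval I M) (lcZeroEval_injective I M)).trans
    (LinearEquiv.ofEq _ _ (range_lcZeroEval I M))

end LocalCohomologyZero

section LocalCohomologyTorsion

open Limits Opposite

variable {R : Type} [CommRing R]

lemma map_pow_smul_eq_bot_of_fg {M : Type} [AddCommGroup M] [Module R M] (I : Ideal R)
    {N : Submodule R M} (hN : N.FG) (h : N ≤ powTorsion I M) : ∃ n, I ^ n • N = ⊥ := by
  obtain ⟨s, rfl⟩ := hN
  have : ∀ m ∈ s, ∃ n, ∀ a ∈ I ^ n, a • m = 0 := fun m hm => h (Submodule.subset_span hm)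
  choose! n hn using this
  refine ⟨s.sup n, ?_⟩
  rw [eq_bot_iff, Submodule.smul_le]
  intro r hr m hm
  have : Submodule.span R (s : Set M) ≤ LinearMap.ker (LinearMap.lsmul R M r) := by
    rw [Submodule.span_le]
    intro m hm
    exact hn m hm r (Ideal.pow_le_pow_right (Finset.le_sup hm) hr)
  exact this hm

lemma injective_powTorsion [IsNoetherianRing R] (I : Ideal R) (E : Type) [AddCommGroup E]
    [Module R E] [hE : Module.Injective R E] : Module.Injective R (powTorsion I E) := by
  apply Module.Baer.injective
  intro J g
  obtain ⟨n, hn⟩ := map_pow_smul_eq_bot_of_fg I (N := LinearMap.range ((powTorsion I E).subtype ∘ₗ g))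
    (by rw [LinearMap.range_eq_map]; exact (isNoetherian_def.1 inferInstance ⊤).map _)
    (by rintro _ ⟨x, rfl⟩; exact (g x).2)
  obtain ⟨k, hk⟩ := I.exists_pow_inf_eq_pow_smul (J : Submodule R R)
  have hk' : I ^ (n + k) ⊓ J ≤ I ^ n • J := by
    have := hk (n + k) (by omega)
    rw [smul_eq_mul, Ideal.mul_top, Nat.add_sub_cancel] at this
    rw [this]
    exact Submodule.smul_mono le_rfl inf_le_right
  have hg : ∀ x : J, (x : R) ∈ I ^ (n + k) → g x = 0 := by
    intro x hx
    have hx' : (x : R) ∈ I ^ n • J := hk' ⟨hx, x.2⟩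
    have h1 : x ∈ I ^ n • (⊤ : Submodule R J) := by
      have : (I ^ n • (⊤ : Submodule R J)).map J.subtype = I ^ n • J := by
        rw [Submodule.map_smul'', Submodule.map_top, Submodule.range_subtype]
      rw [← this] at hx'
      obtain ⟨y, hy, hyx⟩ := hx'
      rwa [← Subtype.ext hyx]
    have h2 : ((powTorsion I E).subtype ∘ₗ g) x ∈ I ^ n •
        LinearMap.range ((powTorsion I E).subtype ∘ₗ g) := by
      rw [LinearMap.range_eq_map, ← Submodule.map_smul'']
      exact ⟨x, h1, rfl⟩
    rw [hn] at h2
    exact Subtype.ext h2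
  let N : Submodule R J := Submodule.comap (Submodule.subtype J) (I ^ (n + k) : Submodule R R)
  let f : (J ⧸ N) →ₗ[R] (R ⧸ I ^ (n + k)) := Submodule.mapQ _ _ J.subtype le_rfl
  have hf : Function.Injective f := by
    rw [← LinearMap.ker_eq_bot, Submodule.ker_mapQ]
    simp [N, Submodule.mkQ_map_self]
  obtain ⟨h, hh⟩ := hE.out f hf ((powTorsion I E).subtype ∘ₗ N.liftQ g (fun x hx => hg x hx))
  have hmem : ∀ r, h (Submodule.Quotient.mk r) ∈ powTorsion I E := by
    intro r
    refine ⟨n + k, fun a ha => ?_⟩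
    rw [← map_smul, ← Submodule.Quotient.mk_smul, (Submodule.Quotient.mk_eq_zero _).2, map_zero]
    exact Ideal.mul_mem_right _ _ ha
  refine ⟨(h ∘ₗ (I ^ (n + k)).mkQ).codRestrict _ hmem, fun x hx => ?_⟩
  apply Subtype.ext
  exact hh (Submodule.Quotient.mk ⟨x, hx⟩)

lemma lc_succ_eq_zero_of_torsion [IsNoetherianRing R] (I : Ideal R) (i : ℕ) :
    ∀ (K : ModuleCat.{0} R) (_ : ∀ m : K, m ∈ powTorsion I K)
      (z : (localCohomology I (i + 1)).obj K), z = 0 := by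
  induction i with
  | zero => ?_
  | succ i ih => ?_
  all_goals
    intro K hK z
    let E : ModuleCat.{0} R := Injective.under K
    have hE' : Injective (ModuleCat.of R E) := inferInstanceAs (Injective (Injective.under K))
    have hE : Module.Injective R E := Module.injective_module_of_injective_object R E
    have hJ := injective_powTorsion I E
    let J : ModuleCat.{0} R := ModuleCat.of R (powTorsion I E)
    have hJ' : Injective J := Module.injective_object_of_injective_module R (powTorsion I E)
    have hmem : ∀ m : K, (Injective.ι K).hom m ∈ powTorsion I E := by
      intro m
      obtain ⟨n, hn⟩ := hK m
      exact ⟨n, fun a ha => by rw [← map_smul, hn a ha, map_zero]⟩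
    let j : K →ₗ[R] powTorsion I E := (Injective.ι K).hom.codRestrict _ hmem
    have hj : Function.Injective j := by
      have : Function.Injective (Injective.ι K).hom := (ModuleCat.mono_iff_injective _).1 inferInstance
      intro a b hab
      exact this (congrArg Subtype.val hab)
    let C : ModuleCat.{0} R := ModuleCat.of R (powTorsion I E ⧸ LinearMap.range j)
    have hC : ∀ m : C, m ∈ powTorsion I C := by
      intro m
      obtain ⟨⟨m, n, hn⟩, rfl⟩ := Submodule.Quotient.mk_surjective _ m
      refine ⟨n, fun a ha => ?_⟩
      rw [← Submodule.Quotient.mk_smul]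
      exact (Submodule.Quotient.mk_eq_zero _).2 (by
        convert (LinearMap.range j).zero_mem
        exact Subtype.ext (hn a ha))
    let S : ShortComplex (ModuleCat.{0} R) := ShortComplex.mk (X₁ := K) (X₂ := J) (X₃ := C)
      (ModuleCat.ofHom j) (ModuleCat.ofHom (LinearMap.range j).mkQ) (by
        ext x
        exact (Submodule.Quotient.mk_eq_zero _).2 ⟨x, rfl⟩)
    have hS : S.ShortExact :=
      { exact := by
          rw [ShortComplex.ShortExact.moduleCat_exact_iff_function_exact]
          exact LinearMap.exact_map_mkQ_range j
        mono_f := (ModuleCat.mono_iff_injective _).2 hj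
        epi_g := (ModuleCat.epi_iff_surjective _).2 (Submodule.mkQ_surjective _) }
    obtain ⟨δ, h1, h2⟩ := exists_lc_connecting I _ hS
    obtain ⟨w, rfl⟩ := (h2 z).1 (lc_injective_eq_zero I _ J _)
  · have hw := hC (lcZeroEval I C w)
    obtain ⟨y, hy⟩ := Submodule.mkQ_surjective (LinearMap.range j) (lcZeroEval I C w)
    have hy2 : (⟨y, y.2⟩ : powTorsion I E) ∈ powTorsion I (powTorsion I E) := by
      obtain ⟨n, hn⟩ := y.2
      exact ⟨n, fun a ha => Subtype.ext (hn a ha)⟩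
    have hy3 : y ∈ LinearMap.range (lcZeroEval I J) := by
      rw [range_lcZeroEval]; exact hy2
    obtain ⟨v, hv⟩ := hy3
    refine (h1 w).2 ⟨v, lcZeroEval_injective I C ?_⟩
    rw [lcZeroEval_map]
    refine Eq.trans ?_ hy
    exact congrArg _ hv
  · rw [ih C hC w, map_zero]

end LocalCohomologyTorsion

section LocalCohomologyModules

variable {R : Type} [CommRing R]

/-- The local cohomology of an unbundled module. -/
abbrev LC (I : Ideal R) (i : ℕ) (M : Type) [AddCommGroup M] [Module R M] : Type :=
  (localCohomology I i).obj (ModuleCat.of R M)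

variable {A B C : Type} [AddCommGroup A] [Module R A] [AddCommGroup B] [Module R B]
  [AddCommGroup C] [Module R C]

/-- Functoriality of local cohomology. -/
def LC.map (I : Ideal R) (i : ℕ) (f : A →ₗ[R] B) : LC I i A →ₗ[R] LC I i B :=
  ((localCohomology I i).map (ModuleCat.ofHom f)).hom

lemma LC.map_comp (I : Ideal R) (i : ℕ) (f : A →ₗ[R] B) (g : B →ₗ[R] C) (z : LC I i A) :
    LC.map I i (g ∘ₗ f) z = LC.map I i g (LC.map I i f z) :=
  congrArg (fun t => t.hom z)
    ((localCohomology I i).map_comp (ModuleCat.ofHom f) (ModuleCat.ofHom g))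

lemma LC.map_smul_id (I : Ideal R) (i : ℕ) (y : R) (z : LC I i A) :
    LC.map I i (LinearMap.lsmul R A y) z = y • z :=
  lc_map_smul I i (ModuleCat.of R A) y z

variable {f : A →ₗ[R] B} {g : B →ₗ[R] C}

lemma shortExact_of_function_exact (hf : Function.Injective f) (hfg : Function.Exact f g)
    (hg : Function.Surjective g) :
    (ShortComplex.mk (ModuleCat.ofHom f) (ModuleCat.ofHom g) (by
      ext x; exact hfg.apply_apply_eq_zero x)).ShortExact :=
  { exact := (ShortComplex.ShortExact.moduleCat_exact_iff_function_exact _).2 hfg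
    mono_f := (ModuleCat.mono_iff_injective _).2 hf
    epi_g := (ModuleCat.epi_iff_surjective _).2 hg }

lemma LC.exact (I : Ideal R) (i : ℕ) (hf : Function.Injective f) (hfg : Function.Exact f g)
    (hg : Function.Surjective g) : Function.Exact (LC.map I i f) (LC.map I i g) :=
  lc_exact I i (shortExact_of_function_exact hf hfg hg)

lemma LC.exists_connecting (I : Ideal R) (i : ℕ) (hf : Function.Injective f)
    (hfg : Function.Exact f g) (hg : Function.Surjective g) :
    ∃ δ : LC I i C →ₗ[R] LC I (i + 1) A,
      Function.Exact (LC.map I i g) δ ∧ Function.Exact δ (LC.map I (i + 1) f) :=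
  exists_lc_connecting I i (shortExact_of_function_exact hf hfg hg)

/-- The zeroth local cohomology is the torsion submodule. -/
def LC.zeroEquiv (I : Ideal R) : LC I 0 A ≃ₗ[R] powTorsion I A :=
  lcZeroEquiv I (ModuleCat.of R A)

lemma LC.zero_subsingleton (I : Ideal R) (h : powTorsion I A = ⊥) : Subsingleton (LC I 0 A) := by
  have : Subsingleton (powTorsion I A) := by rw [h]; infer_instance
  exact (LC.zeroEquiv I).toEquiv.subsingleton

lemma LC.eq_zero_of_torsion [IsNoetherianRing R] (I : Ideal R) (i : ℕ)
    (h : powTorsion I A = ⊤) (z : LC I (i + 1) A) : z = 0 :=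
  lc_succ_eq_zero_of_torsion I i (ModuleCat.of R A) (fun _ => h.symm ▸ Submodule.mem_top) z

lemma powTorsion_ker_eq_top {I : Ideal R} (h : LinearMap.ker g ≤ powTorsion I B) :
    powTorsion I (LinearMap.ker g) = ⊤ := by
  rw [eq_top_iff]
  rintro ⟨x, hx⟩ -
  obtain ⟨n, hn⟩ := h hx
  exact ⟨n, fun a ha => Subtype.ext (hn a ha)⟩

lemma LC.map_surjective_of_ker_torsion [IsNoetherianRing R] (I : Ideal R) (i : ℕ)
    (hg : Function.Surjective g) (h : LinearMap.ker g ≤ powTorsion I B) :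
    Function.Surjective (LC.map I i g) := by
  obtain ⟨δ, h1, -⟩ := LC.exists_connecting I i (LinearMap.ker g).injective_subtype
    (LinearMap.exact_subtype_ker_map g) hg
  exact fun z => (h1 z).1 (LC.eq_zero_of_torsion I i (powTorsion_ker_eq_top h) _)

lemma LC.map_bijective_of_ker_torsion [IsNoetherianRing R] (I : Ideal R) (i : ℕ)
    (hg : Function.Surjective g) (h : LinearMap.ker g ≤ powTorsion I B) :
    Function.Bijective (LC.map I (i + 1) g) := by
  refine ⟨?_, LC.map_surjective_of_ker_torsion I _ hg h⟩
  rw [injective_iff_map_eq_zero]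
  intro z hz
  obtain ⟨w, rfl⟩ := (LC.exact I (i + 1) (LinearMap.ker g).injective_subtype
    (LinearMap.exact_subtype_ker_map g) hg z).1 hz
  rw [LC.eq_zero_of_torsion I i (powTorsion_ker_eq_top h) w, map_zero]

lemma exists_pow_le_annihilator_powTorsion [IsNoetherianRing R] [Module.Finite R A] (I : Ideal R) :
    ∃ n, I ^ n ≤ Module.annihilator R (powTorsion I A) := by
  obtain ⟨n, hn⟩ := map_pow_smul_eq_bot_of_fg I (N := powTorsion I A)
    (isNoetherian_def.1 inferInstance _) le_rfl
  refine ⟨n, fun a ha => Module.mem_annihilator.2 fun m => Subtype.ext ?_⟩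
  have : a • (m : A) ∈ I ^ n • powTorsion I A := Submodule.smul_mem_smul ha m.2
  rw [hn] at this
  exact this

lemma powTorsion_quotient_powTorsion [IsNoetherianRing R] (I : Ideal R) :
    powTorsion I (A ⧸ powTorsion I A) = ⊥ := by
  rw [eq_bot_iff]
  intro z
  obtain ⟨m, rfl⟩ := Submodule.Quotient.mk_surjective _ z
  rintro ⟨n, hn⟩
  refine (Submodule.Quotient.mk_eq_zero _).2 ?_
  obtain ⟨k, hk⟩ := map_pow_smul_eq_bot_of_fg I
    (N := Submodule.map (LinearMap.toSpanSingleton R A m) (I ^ n : Submodule R R))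
    (Submodule.FG.map _ (IsNoetherian.noetherian (I ^ n))) (by
      rintro _ ⟨a, ha, rfl⟩
      have := hn a ha
      rw [← Submodule.Quotient.mk_smul] at this
      exact (Submodule.Quotient.mk_eq_zero _).1 this)
  refine ⟨k + n, fun a ha => ?_⟩
  rw [pow_add] at ha
  have h1 : I ^ k * I ^ n ≤ LinearMap.ker (LinearMap.toSpanSingleton R A m) := by
    rw [Ideal.mul_le]
    intro r hr s hs
    have : r • s • m ∈ (⊥ : Submodule R A) := by
      rw [← hk]
      exact Submodule.smul_mem_smul hr ⟨s, hs, rfl⟩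
    rw [LinearMap.mem_ker, LinearMap.toSpanSingleton_apply, mul_smul]
    exact this
  exact h1 ha

lemma exists_pow_le_annihilator_of_exact {I : Ideal R} (hfg : Function.Exact f g)
    (hA : ∃ n, I ^ n ≤ Module.annihilator R A) (hC : ∃ n, I ^ n ≤ Module.annihilator R C) :
    ∃ n, I ^ n ≤ Module.annihilator R B := by
  obtain ⟨n, hn⟩ := hA
  obtain ⟨m, hm⟩ := hC
  refine ⟨n + m, ?_⟩
  rw [pow_add, Ideal.mul_le]
  intro r hr s hs
  rw [Module.mem_annihilator]
  intro b
  obtain ⟨a, ha⟩ := (hfg (s • b)).1 (by rw [map_smul, Module.mem_annihilator.1 (hm hs)])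
  rw [mul_smul, ← ha, ← map_smul, Module.mem_annihilator.1 (hn hr), map_zero]

end LocalCohomologyModules

section AssociatedPrimes

variable {R : Type} [CommRing R] [IsNoetherianRing R] {M : Type} [AddCommGroup M] [Module R M]

lemma exists_colon_singleton_of_mem_associatedPrimes {P : Ideal R} (hP : P ∈ associatedPrimes R M) :
    P.IsPrime ∧ ∃ m : M, ∀ r, r ∈ P ↔ r • m = 0 := by
  obtain ⟨h, m, rfl⟩ := isAssociatedPrime_iff.1 hP
  exact ⟨h, m, fun r => by simp [Submodule.mem_colon_singleton]⟩

lemma mem_associatedPrimes_quotient_powTorsion {I P : Ideal R} (hP : P ∈ associatedPrimes R M)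
    (hI : ¬ I ≤ P) : P ∈ associatedPrimes R (M ⧸ powTorsion I M) := by
  obtain ⟨h, m, hm⟩ := exists_colon_singleton_of_mem_associatedPrimes hP
  refine isAssociatedPrime_iff.2 ⟨h, Submodule.Quotient.mk m, ?_⟩
  ext r
  rw [Submodule.mem_colon_singleton, Submodule.mem_bot, ← Submodule.Quotient.mk_smul,
    Submodule.Quotient.mk_eq_zero, hm]
  refine ⟨fun h0 => h0 ▸ zero_mem _, ?_⟩
  rintro ⟨n, hn⟩
  rw [← hm]
  have h1 : I ^ n * Ideal.span {r} ≤ P := by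
    rw [Ideal.mul_le]
    intro a ha b hb
    obtain ⟨c, rfl⟩ := Ideal.mem_span_singleton'.1 hb
    rw [hm, mul_left_comm, mul_smul, mul_smul, hn a ha, smul_zero]
  rcases h.mul_le.1 h1 with h2 | h2
  · exact absurd (h.le_of_pow_le h2) hI
  · exact h2 (Ideal.mem_span_singleton_self r)

lemma exists_isSMulRegular_of_powTorsion_eq_bot [IsLocalRing R] [Module.Finite R M]
    (h : powTorsion (maximalIdeal R) M = ⊥) : ∃ x ∈ maximalIdeal R, IsSMulRegular M x := by
  by_contra! hc
  have h1 : (maximalIdeal R : Set R) ⊆ ⋃ p ∈ (associatedPrimes.finite R M).toFinset, (p : Set R) := by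
    intro x hx
    have : x ∈ ⋃ p ∈ associatedPrimes R M, (p : Set R) := by
      rw [biUnion_associatedPrimes_eq_compl_regular]
      exact hc x hx
    simpa using this
  obtain ⟨P, hP, hle⟩ := (Ideal.subset_union_prime (f := id) ⊤ ⊤ (fun p hp _ _ => by
    have : p ∈ associatedPrimes R M := by simpa using hp
    exact this.isPrime)).1 h1
  have hP' : P ∈ associatedPrimes R M := by simpa using hP
  obtain ⟨hpr, m, hm⟩ := exists_colon_singleton_of_mem_associatedPrimes hP'
  have : m ∈ powTorsion (maximalIdeal R) M := ⟨1, fun a ha => (hm a).1 (hle (by simpa using ha))⟩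
  rw [h, Submodule.mem_bot] at this
  exact hpr.ne_top ((Ideal.eq_top_iff_one _).2 ((hm 1).2 (by simp [this])))

lemma mem_associatedPrimes_quotient_of_minimal [Module.Finite R M] {x : R} (hx : IsSMulRegular M x)
    {P Q : Ideal R} (hP : P ∈ associatedPrimes R M) (hQ : Q ∈ (P ⊔ Ideal.span {x}).minimalPrimes) :
    Q ∈ associatedPrimes R (M ⧸ LinearMap.range (LinearMap.lsmul R M x)) := by
  obtain ⟨h, m, hm⟩ := exists_colon_singleton_of_mem_associatedPrimes hP
  let T : Submodule R M := Submodule.torsionBySet R M P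
  have hT : ∀ n : M, n ∈ T ↔ ∀ p ∈ P, p • n = 0 := fun n => by
    simp [T, Submodule.mem_torsionBySet_iff]
  let W := LinearMap.range (LinearMap.lsmul R M x)
  let f : T →ₗ[R] (M ⧸ W) := W.mkQ ∘ₗ T.subtype
  have hker : LinearMap.ker f = Ideal.span {x} • (⊤ : Submodule R T) := by
    ext t
    rw [Submodule.ideal_span_singleton_smul, Submodule.mem_smul_pointwise_iff_exists]
    have h1 : t ∈ LinearMap.ker f ↔ (t : M) ∈ W := Submodule.Quotient.mk_eq_zero _
    rw [h1]
    constructor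
    · rintro ⟨n, hn⟩
      refine ⟨⟨n, (hT n).2 fun p hp => hx ?_⟩, Submodule.mem_top, Subtype.ext hn⟩
      change x • p • n = x • 0
      rw [smul_comm, smul_zero]
      exact (congrArg (p • ·) hn).trans ((hT t).1 t.2 p hp)
    · rintro ⟨n, -, rfl⟩
      exact ⟨n, rfl⟩
  let g : (T ⧸ (Ideal.span {x} • (⊤ : Submodule R T))) →ₗ[R] (M ⧸ W) :=
    Submodule.liftQ _ f hker.ge
  have hg : Function.Injective g := by
    rw [← LinearMap.ker_eq_bot, Submodule.ker_liftQ_eq_bot _ _ _ hker.le]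
  refine associatedPrimes.subset_of_injective hg ?_
  apply Module.associatedPrimes.minimalPrimes_annihilator_subset_associatedPrimes
  have hann : Module.annihilator R T = P := by
    apply le_antisymm
    · intro r hr
      rw [hm]
      exact congrArg Subtype.val (Module.mem_annihilator.1 hr ⟨m, (hT m).2 fun p hp => (hm p).1 hp⟩)
    · intro r hr
      exact Module.mem_annihilator.2 fun t => Subtype.ext ((hT t).1 t.2 r hr)
  have hprime : Q.IsPrime := hQ.1.1
  have hsupp : PrimeSpectrum.zeroLocus (Module.annihilator R
      (T ⧸ (Ideal.span {x} • (⊤ : Submodule R T))) : Set R) =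
      PrimeSpectrum.zeroLocus ((P ⊔ Ideal.span {x} : Ideal R) : Set R) := by
    rw [← Module.support_eq_zeroLocus, Module.support_quotient, Module.support_eq_zeroLocus, hann,
      PrimeSpectrum.zeroLocus_sup]
  have hiff : ∀ q : Ideal R, q.IsPrime → (Module.annihilator R
      (T ⧸ (Ideal.span {x} • (⊤ : Submodule R T))) ≤ q ↔ P ⊔ Ideal.span {x} ≤ q) := by
    intro q hq
    have := Set.ext_iff.1 hsupp ⟨q, hq⟩
    simpa only [PrimeSpectrum.mem_zeroLocus, SetLike.coe_subset_coe] using this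
  refine ⟨⟨hprime, (hiff Q hprime).2 hQ.1.2⟩, ?_⟩
  rintro q ⟨hq, hle⟩ hqQ
  exact hQ.2 ⟨hq, (hiff q hq).1 hle⟩ hqQ

end AssociatedPrimes

section DimensionBound

variable {R : Type} [CommRing R] [IsNoetherianRing R]

lemma exists_pow_le_annihilator_LC_zero (I : Ideal R) (M : Type) [AddCommGroup M] [Module R M]
    [Module.Finite R M] : ∃ n, I ^ n ≤ Module.annihilator R (LC I 0 M) := by
  rw [(LC.zeroEquiv I).annihilator_eq]
  exact exists_pow_le_annihilator_powTorsion I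

variable [IsLocalRing R]

lemma not_pow_maximalIdeal_le_sup_span {M : Type} [AddCommGroup M] [Module R M]
    [Module.Finite R M] (hM : powTorsion (maximalIdeal R) M = ⊥)
    (hM1 : ∃ n, maximalIdeal R ^ n ≤ Module.annihilator R (LC (maximalIdeal R) 1 M))
    {P : Ideal R} (hP : P ∈ associatedPrimes R M) {x : R} (hxm : x ∈ maximalIdeal R)
    (hx : IsSMulRegular M x) (n : ℕ) : ¬ maximalIdeal R ^ n ≤ P ⊔ Ideal.span {x} := by
  intro hn
  obtain ⟨hPp, f, hf⟩ := (isAssociatedPrime_iff_exists_injective_linearMap _ _).1 hP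
  have hB : powTorsion (maximalIdeal R) (R ⧸ P) = ⊥ := by
    rw [eq_bot_iff]
    rintro b ⟨k, hk⟩
    have : f b ∈ powTorsion (maximalIdeal R) M :=
      ⟨k, fun a ha => by rw [← map_smul, hk a ha, map_zero]⟩
    rw [hM, Submodule.mem_bot] at this
    exact hf (this.trans (map_zero f).symm)
  obtain ⟨δ, -, hδ⟩ := LC.exists_connecting (maximalIdeal R) 0 hf
    (LinearMap.exact_map_mkQ_range f) (Submodule.mkQ_surjective _)
  obtain ⟨k, hk⟩ := exists_pow_le_annihilator_of_exact hδ
    (exists_pow_le_annihilator_LC_zero (maximalIdeal R) _) hM1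
  have hxB : ∀ b : R ⧸ P, x • b = 0 → b = 0 := by
    intro b hb
    have h1 : x • f b = x • 0 := by rw [← map_smul, hb, map_zero, smul_zero]
    exact hf ((hx h1).trans (map_zero f).symm)
  have hxB' : Function.Injective (LinearMap.lsmul R (R ⧸ P) (x ^ (k + 1))) := by
    rw [injective_iff_map_eq_zero]
    generalize k + 1 = j
    induction j with
    | zero => intro b hb; simpa using hb
    | succ j ih =>
      intro b hb
      refine hxB b (ih _ ?_)
      rwa [LinearMap.lsmul_apply, smul_smul, ← pow_succ]
  obtain ⟨δ', hδ', -⟩ := LC.exists_connecting (maximalIdeal R) 0 hxB'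
    (LinearMap.exact_map_mkQ_range _) (Submodule.mkQ_surjective _)
  have := LC.zero_subsingleton (maximalIdeal R) hB
  have hinj : ∀ z, δ' z = 0 → z = 0 := by
    intro z hz
    obtain ⟨w, rfl⟩ := (hδ' z).1 hz
    rw [Subsingleton.elim w 0, map_zero]
  let W := LinearMap.range (LinearMap.lsmul R (R ⧸ P) (x ^ (k + 1)))
  have hmemW : ∀ a : R, (Submodule.Quotient.mk a : R ⧸ P) ∈ W ↔ a ∈ P ⊔ Ideal.span {x ^ (k + 1)} := by
    intro a
    constructor
    · rintro ⟨b, hb⟩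
      obtain ⟨b, rfl⟩ := Submodule.Quotient.mk_surjective _ b
      have h1 : (Submodule.Quotient.mk (x ^ (k + 1) * b) : R ⧸ P) = Submodule.Quotient.mk a := hb
      rw [eq_comm, Submodule.Quotient.eq] at h1
      rw [← sub_add_cancel a (x ^ (k + 1) * b)]
      exact Ideal.add_mem _ (Ideal.mem_sup_left h1)
        (Ideal.mem_sup_right (Ideal.mul_mem_right _ _ (Ideal.mem_span_singleton_self _)))
    · intro ha
      obtain ⟨p, hp, c, hc, rfl⟩ := Submodule.mem_sup.1 ha
      obtain ⟨b, rfl⟩ := Ideal.mem_span_singleton.1 hc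
      refine ⟨Submodule.Quotient.mk b, ?_⟩
      change (Submodule.Quotient.mk (x ^ (k + 1) * b) : R ⧸ P) = _
      rw [eq_comm, Submodule.Quotient.eq]
      simpa using hp
  have h1 : W.mkQ (Submodule.Quotient.mk (1 : R)) ∈ powTorsion (maximalIdeal R) ((R ⧸ P) ⧸ W) := by
    refine ⟨n * (1 + (k + 1)), fun a ha => ?_⟩
    rw [← map_smul]
    refine (Submodule.Quotient.mk_eq_zero _).2 ?_
    rw [← Submodule.Quotient.mk_smul, hmemW, smul_eq_mul, mul_one]
    have h2 : a ∈ P ^ 1 ⊔ Ideal.span {x} ^ (k + 1) := by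
      rw [pow_mul] at ha
      exact Ideal.sup_pow_add_le_pow_sup_pow (Ideal.pow_right_mono hn _ ha)
    rwa [pow_one, Ideal.span_singleton_pow] at h2
  let v := (LC.zeroEquiv (maximalIdeal R)).symm ⟨_, h1⟩
  have hv : x ^ k • v = 0 := by
    apply hinj
    rw [map_smul]
    exact Module.mem_annihilator.1 (hk (Ideal.pow_mem_pow hxm k)) _
  have hv2 : x ^ k • W.mkQ (Submodule.Quotient.mk (1 : R)) = 0 := by
    have := congrArg (LC.zeroEquiv (maximalIdeal R)) hv
    rw [map_smul, map_zero, LinearEquiv.apply_symm_apply] at this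
    exact congrArg Subtype.val this
  rw [← map_smul] at hv2
  have hv3 := (hmemW _).1 ((Submodule.Quotient.mk_eq_zero _).1 hv2)
  beta_reduce at hv3
  rw [smul_eq_mul, mul_one] at hv3
  obtain ⟨p, hp, c, hc, hpc⟩ := Submodule.mem_sup.1 hv3
  obtain ⟨b, rfl⟩ := Ideal.mem_span_singleton.1 hc
  have h5 : x ^ k * (1 - x * b) ∈ P := by
    have : x ^ k * (1 - x * b) = p := by linear_combination -hpc
    rwa [this]
  rcases hPp.mem_or_mem h5 with h6 | h6
  · have h7 := hxB (Submodule.Quotient.mk 1) (by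
      rw [← Submodule.Quotient.mk_smul, Submodule.Quotient.mk_eq_zero, smul_eq_mul, mul_one]
      exact hPp.mem_of_pow_mem k h6)
    exact hPp.ne_top ((Ideal.eq_top_iff_one _).2 ((Submodule.Quotient.mk_eq_zero _).1 h7))
  · have h8 : IsUnit (1 - x * b) := by
      by_contra hu
      have h9 : (1 : R) ∈ maximalIdeal R := by
        rw [← sub_add_cancel 1 (x * b)]
        exact Ideal.add_mem _ ((mem_maximalIdeal _).2 hu) (Ideal.mul_mem_right _ _ hxm)
      exact (maximalIdeal.isMaximal R).ne_top ((Ideal.eq_top_iff_one _).2 h9)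
    exact hPp.ne_top (Ideal.eq_top_of_isUnit_mem _ h6 h8)

theorem lt_ringKrullDim_quotient_of_mem_associatedPrimes (t : ℕ) :
    ∀ (M : Type) [AddCommGroup M] [Module R M] [Module.Finite R M],
    (∀ i < t, ∃ n, maximalIdeal R ^ n ≤ Module.annihilator R (LC (maximalIdeal R) (i + 1) M)) →
    ∀ P ∈ associatedPrimes R M, P ≠ maximalIdeal R → ((t + 1 : ℕ) : WithBot ℕ∞) ≤ ringKrullDim (R ⧸ P) := by
  have key : ∀ P Q : Ideal R, P.IsPrime → P < Q → ringKrullDim (R ⧸ Q) + 1 ≤ ringKrullDim (R ⧸ P) := by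
    intro P Q hP hPQ
    obtain ⟨r, hrQ, hrP⟩ := SetLike.exists_of_lt hPQ
    refine ringKrullDim_succ_le_of_surjective (Ideal.Quotient.factor hPQ.le)
      (Ideal.Quotient.factor_surjective hPQ.le) (r := Ideal.Quotient.mk P r) ?_ ?_
    · exact mem_nonZeroDivisors_of_ne_zero (by rwa [Ne, Ideal.Quotient.eq_zero_iff_mem])
    · rwa [Ideal.Quotient.factor_mk, Ideal.Quotient.eq_zero_iff_mem]
  induction t with
  | zero =>
    intro M _ _ _ _ P hP hPm
    have hlt : P < maximalIdeal R := lt_of_le_of_ne (le_maximalIdeal hP.isPrime.ne_top) hPm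
    have h0 : (0 : WithBot ℕ∞) ≤ ringKrullDim (R ⧸ maximalIdeal R) := ringKrullDim_nonneg_of_nontrivial
    calc ((0 + 1 : ℕ) : WithBot ℕ∞) = 0 + 1 := by norm_num
      _ ≤ ringKrullDim (R ⧸ maximalIdeal R) + 1 := by gcongr
      _ ≤ _ := key _ _ hP.isPrime hlt
  | succ t ih =>
    intro M _ _ _ hM P hP hPm
    let N := M ⧸ powTorsion (maximalIdeal R) M
    have hNt : powTorsion (maximalIdeal R) N = ⊥ := powTorsion_quotient_powTorsion _
    have hN : ∀ i < t + 1, ∃ n, maximalIdeal R ^ n ≤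
        Module.annihilator R (LC (maximalIdeal R) (i + 1) N) := by
      intro i hi
      obtain ⟨n, hn⟩ := hM i hi
      exact ⟨n, hn.trans (LinearMap.annihilator_le_of_surjective _
        (LC.map_surjective_of_ker_torsion (maximalIdeal R) (i + 1)
          (Submodule.mkQ_surjective (powTorsion (maximalIdeal R) M)) (Submodule.ker_mkQ _).le))⟩
    have hPN : P ∈ associatedPrimes R N := mem_associatedPrimes_quotient_powTorsion hP (fun h =>
      hPm ((maximalIdeal.isMaximal R).eq_of_le hP.isPrime.ne_top h).symm)
    obtain ⟨x, hxm, hx⟩ := exists_isSMulRegular_of_powTorsion_eq_bot hNt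
    have hle : P ⊔ Ideal.span {x} ≤ maximalIdeal R :=
      sup_le (le_maximalIdeal hP.isPrime.ne_top) ((Ideal.span_singleton_le_iff_mem _).2 hxm)
    obtain ⟨Q, hQ, hQm⟩ : ∃ Q ∈ (P ⊔ Ideal.span {x}).minimalPrimes, Q ≠ maximalIdeal R := by
      by_contra! hc
      have hrad : maximalIdeal R ≤ (P ⊔ Ideal.span {x}).radical := by
        rw [← Ideal.sInf_minimalPrimes]
        exact le_sInf fun Q hQ => (hc Q hQ).ge
      obtain ⟨n, hn⟩ := Ideal.exists_pow_le_of_le_radical_of_fg hrad (IsNoetherian.noetherian _)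
      exact not_pow_maximalIdeal_le_sup_span hNt (hN 0 (by omega)) hPN hxm hx n hn
    have hQass := mem_associatedPrimes_quotient_of_minimal hx hPN hQ
    have hxP : x ∉ P := by
      intro hxP
      obtain ⟨hp, m, hm⟩ := exists_colon_singleton_of_mem_associatedPrimes hPN
      have h0 : m = 0 := hx (((hm x).1 hxP).trans (smul_zero x).symm)
      exact hp.ne_top ((Ideal.eq_top_iff_one _).2 ((hm 1).2 (by rw [h0, smul_zero])))
    have hPQ : P < Q := by
      refine lt_of_le_of_ne (le_sup_left.trans hQ.1.2) ?_
      rintro rfl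
      exact hxP (hQ.1.2 (Ideal.mem_sup_right (Ideal.mem_span_singleton_self x)))
    have := ih _ (fun i hi => by
      obtain ⟨δ, h1, h2⟩ := LC.exists_connecting (maximalIdeal R) (i + 1)
        (f := LinearMap.lsmul R N x) hx
        (LinearMap.exact_map_mkQ_range _) (Submodule.mkQ_surjective _)
      exact exists_pow_le_annihilator_of_exact h1 (hN i (by omega)) (hN (i + 1) (by omega)))
      Q hQass hQm
    calc ((t + 1 + 1 : ℕ) : WithBot ℕ∞) = ((t + 1 : ℕ) : WithBot ℕ∞) + 1 := by norm_cast
      _ ≤ ringKrullDim (R ⧸ Q) + 1 := by gcongr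
      _ ≤ _ := key _ _ hP.isPrime hPQ

end DimensionBound

section SocleLength

variable {R : Type} [CommRing R] {A B C : Type} [AddCommGroup A] [AddCommGroup B]
  [AddCommGroup C] [Module R A] [Module R B] [Module R C] {f : A →ₗ[R] B} {g : B →ₗ[R] C}

lemma length_le_add_of_exact (hfg : Function.Exact f g) :
    Module.length R B ≤ Module.length R A + Module.length R C := by
  rw [Module.length_eq_add_of_exact (LinearMap.ker g).subtype (LinearMap.ker g).mkQ
    (LinearMap.ker g).injective_subtype (Submodule.mkQ_surjective _)
    (LinearMap.exact_subtype_mkQ _)]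
  refine add_le_add ?_ ?_
  · rw [hfg.linearMap_ker_eq]
    exact Module.length_le_of_surjective f.rangeRestrict f.surjective_rangeRestrict
  · exact Module.length_le_of_injective _ (LinearMap.ker_eq_bot.1
      ((LinearMap.ker g).ker_liftQ_eq_bot g le_rfl le_rfl))

variable [IsLocalRing R]

variable (R A) in
/-- The length of the socle of a module over a local ring. -/
def socleLength : ℕ∞ := Module.length R (Submodule.torsionBySet R A (maximalIdeal R : Set R))

/-- The map induced on socles. -/
def socleMap (f : A →ₗ[R] B) : Submodule.torsionBySet R A (maximalIdeal R : Set R) →ₗ[R]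
    Submodule.torsionBySet R B (maximalIdeal R : Set R) :=
  f.restrict fun x hx => by
    rw [Submodule.mem_torsionBySet_iff] at hx ⊢
    intro a
    rw [← map_smul, hx a, map_zero]

lemma socleLength_le_of_injective (hf : Function.Injective f) :
    socleLength R A ≤ socleLength R B :=
  Module.length_le_of_injective (socleMap f) fun _ _ h => Subtype.ext (hf (congrArg Subtype.val h))

lemma LinearEquiv.socleLength_eq (e : A ≃ₗ[R] B) : socleLength R A = socleLength R B :=
  le_antisymm (socleLength_le_of_injective (f := (e : A →ₗ[R] B)) e.injective)
    (socleLength_le_of_injective (f := (e.symm : B →ₗ[R] A)) e.symm.injective)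

lemma socleLength_le_add_of_exact (hf : Function.Injective f) (hfg : Function.Exact f g) :
    socleLength R B ≤ socleLength R A + socleLength R C := by
  refine length_le_add_of_exact (f := socleMap f) (g := socleMap g) fun z => ⟨fun hz => ?_, ?_⟩
  · obtain ⟨w, hw⟩ := (hfg z).1 (congrArg Subtype.val hz)
    refine ⟨⟨w, ?_⟩, Subtype.ext hw⟩
    have := z.2
    rw [Submodule.mem_torsionBySet_iff] at this ⊢
    intro a
    apply hf
    rw [map_smul, hw, this, map_zero]
  · rintro ⟨w, rfl⟩
    exact Subtype.ext (hfg.apply_apply_eq_zero w)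

end SocleLength

section FilterRegular

variable {R : Type} [CommRing R] [IsNoetherianRing R] [IsLocalRing R]

lemma ringKrullDim_quotient_le_of_radical {P : Ideal R} [hP : P.IsPrime] {s : Set R}
    (hs : s.Finite) (hsm : s ⊆ maximalIdeal R)
    (h : maximalIdeal R ≤ (P ⊔ Ideal.span s).radical) :
    ringKrullDim (R ⧸ P) ≤ (s.ncard : ℕ∞) := by
  have := IsLocalRing.of_surjective' (Ideal.Quotient.mk P) Ideal.Quotient.mk_surjective
  rw [← IsLocalRing.maximalIdeal_height_eq_ringKrullDim]
  have hmap : ∀ a : R, a ∈ maximalIdeal R ↔ Ideal.Quotient.mk P a ∈ maximalIdeal (R ⧸ P) := by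
    intro a
    rw [← Ideal.mem_comap]
    have h1 : (maximalIdeal (R ⧸ P)).comap (Ideal.Quotient.mk P) = maximalIdeal R :=
      IsLocalRing.eq_maximalIdeal
        (Ideal.comap_isMaximal_of_surjective _ Ideal.Quotient.mk_surjective)
    rw [h1]
  have h1 : maximalIdeal (R ⧸ P) ∈ (Ideal.span (Ideal.Quotient.mk P '' s)).minimalPrimes := by
    refine ⟨⟨inferInstance, ?_⟩, ?_⟩
    · rw [Ideal.span_le]
      rintro _ ⟨a, ha, rfl⟩
      exact (hmap a).1 (hsm ha)
    rintro Q ⟨hQ, hsQ⟩ - z hz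
    obtain ⟨a, rfl⟩ := Ideal.Quotient.mk_surjective z
    have h2 : (P ⊔ Ideal.span s).radical ≤ Q.comap (Ideal.Quotient.mk P) := by
      refine (hQ.comap _).radical_le_iff.2 (sup_le ?_ ?_)
      · intro p hp
        rw [Ideal.mem_comap, Ideal.Quotient.eq_zero_iff_mem.2 hp]
        exact Q.zero_mem
      · rw [Ideal.span_le]
        exact fun b hb => hsQ (Ideal.subset_span ⟨b, hb, rfl⟩)
    exact h2 (h ((hmap a).2 hz))
  exact WithBot.coe_le_coe.2 ((Ideal.height_le_card_of_mem_minimalPrimes_span (hs.image _) h1).trans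
    (by exact_mod_cast Set.ncard_image_le hs))

lemma ker_lsmul_le_powTorsion (J : Ideal R) {y : R} {t : ℕ} {s : Set R}
    (hfin : s.Finite) (hsm : s ⊆ maximalIdeal R) (hs : s.ncard ≤ t)
    (hrad : maximalIdeal R ≤ (J ⊔ Ideal.span {y} ⊔ Ideal.span s).radical)
    (h : ∀ i < t, ∃ n, maximalIdeal R ^ n ≤
      Module.annihilator R (LC (maximalIdeal R) (i + 1) (R ⧸ J))) :
    LinearMap.ker (LinearMap.lsmul R (R ⧸ J) y) ≤ powTorsion (maximalIdeal R) (R ⧸ J) := by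
  intro m hm
  have hrad' : maximalIdeal R ≤ (Module.annihilator R (Submodule.span R {m})).radical := by
    rw [← Ideal.sInf_minimalPrimes]
    refine le_sInf fun P hP => ?_
    have hPass := Module.associatedPrimes.minimalPrimes_annihilator_subset_associatedPrimes R _ hP
    have hPM : P ∈ associatedPrimes R (R ⧸ J) := associatedPrimes.subset_of_injective
      (Submodule.span R {m}).injective_subtype hPass
    have := hPass.isPrime
    have hyP : y ∈ P := hP.1.2 (by
      rw [Submodule.mem_annihilator_span_singleton]
      exact hm)
    have hJP : J ≤ P := fun a ha => hP.1.2 (by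
      rw [Submodule.mem_annihilator_span_singleton]
      obtain ⟨m, rfl⟩ := Ideal.Quotient.mk_surjective m
      exact Ideal.Quotient.eq_zero_iff_mem.2 (Ideal.mul_mem_right _ _ ha))
    by_contra hPm
    have h1 := lt_ringKrullDim_quotient_of_mem_associatedPrimes t _ h P hPM (fun e => hPm e.ge)
    have h2 : ringKrullDim (R ⧸ P) ≤ (s.ncard : ℕ∞) := ringKrullDim_quotient_le_of_radical hfin hsm
      (hrad.trans (Ideal.radical_mono (sup_le_sup_right
        (sup_le hJP ((Ideal.span_singleton_le_iff_mem _).2 hyP)) _)))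
    have h3 := h1.trans (h2.trans (WithBot.coe_le_coe.2 (Nat.cast_le.2 hs)))
    have h4 : t + 1 ≤ t := by exact_mod_cast h3
    omega
  obtain ⟨n, hn⟩ := Ideal.exists_pow_le_of_le_radical_of_fg hrad' (IsNoetherian.noetherian _)
  exact ⟨n, fun a ha => (Submodule.mem_annihilator_span_singleton _ _).1 (hn ha)⟩

end FilterRegular

section SocleInequality

variable {R : Type} [CommRing R] [IsNoetherianRing R] [IsLocalRing R]
  {M C : Type} [AddCommGroup M] [Module R M] [AddCommGroup C] [Module R C]

lemma socleLength_LC_le_add {y : R} {p : M →ₗ[R] C} (hp : Function.Surjective p)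
    (hyp : Function.Exact (LinearMap.lsmul R M y) p) (I : Ideal R)
    (hker : LinearMap.ker (LinearMap.lsmul R M y) ≤ powTorsion I M) (i : ℕ)
    (hi : ∀ z : LC I i M, y • z = 0) :
    socleLength R (LC I i C) ≤ socleLength R (LC I i M) + socleLength R (LC I (i + 1) M) := by
  set l := LinearMap.lsmul R M y with hl
  have hker' : LinearMap.ker l.rangeRestrict ≤ powTorsion I M := by
    rwa [LinearMap.ker_rangeRestrict]
  have hex : Function.Exact (LinearMap.range l).subtype p := by
    rw [LinearMap.exact_iff, Submodule.range_subtype, ← LinearMap.exact_iff]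
    exact hyp
  have hinj := (LinearMap.range l).injective_subtype
  obtain ⟨δ, h1, -⟩ := LC.exists_connecting I i hinj hex hp
  have h2 := LC.exact I i hinj hex hp
  have h3 : Function.Injective (LC.map I i p) := by
    rw [injective_iff_map_eq_zero]
    intro z hz
    obtain ⟨w, rfl⟩ := (h2 z).1 hz
    obtain ⟨w, rfl⟩ := LC.map_surjective_of_ker_torsion I i l.surjective_rangeRestrict hker' w
    rw [← LC.map_comp]
    exact (LC.map_smul_id I i y w).trans (hi w)
  refine (socleLength_le_add_of_exact h3 h1).trans (add_le_add le_rfl ?_)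
  exact (LinearEquiv.ofBijective _ (LC.map_bijective_of_ker_torsion I i
    l.surjective_rangeRestrict hker')).symm.socleLength_eq.le

end SocleInequality

section LocalCohomologyEquiv

variable {R : Type} [CommRing R] {A B : Type} [AddCommGroup A] [AddCommGroup B]
  [Module R A] [Module R B]

lemma LC.map_id (I : Ideal R) (i : ℕ) (z : LC I i A) : LC.map I i LinearMap.id z = z :=
  congrArg (fun t => t.hom z) ((localCohomology I i).map_id (ModuleCat.of R A))

/-- Local cohomology of isomorphic modules. -/
def LC.mapEquiv (I : Ideal R) (i : ℕ) (e : A ≃ₗ[R] B) : LC I i A ≃ₗ[R] LC I i B :=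
  LinearEquiv.ofLinearMap (LC.map I i e) (LC.map I i e.symm)
    (by
      ext z
      change LC.map I i (e : A →ₗ[R] B) (LC.map I i (e.symm : B →ₗ[R] A) z) = z
      rw [← LC.map_comp, e.comp_symm, LC.map_id])
    (by
      ext z
      change LC.map I i (e.symm : B →ₗ[R] A) (LC.map I i (e : A →ₗ[R] B) z) = z
      rw [← LC.map_comp, e.symm_comp, LC.map_id])

lemma smul_mem_torsion_eq_zero {I : Ideal R} {y : R} (h : ∀ z : LC I 0 A, y • z = 0) {m : A}
    (hm : m ∈ powTorsion I A) : y • m = 0 := by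
  have h1 := h ((LC.zeroEquiv I).symm ⟨m, hm⟩)
  rw [← map_smul, LinearEquiv.map_eq_zero_iff] at h1
  exact congrArg Subtype.val h1

variable [IsLocalRing R]

variable (R A) in
lemma socleLength_le_LC_zero : socleLength R A ≤ socleLength R (LC (maximalIdeal R) 0 A) := by
  rw [(LC.zeroEquiv (A := A) (maximalIdeal R)).socleLength_eq]
  let φ : Submodule.torsionBySet R A (maximalIdeal R : Set R) →ₗ[R]
      Submodule.torsionBySet R (powTorsion (maximalIdeal R) A) (maximalIdeal R : Set R) :=
    LinearMap.codRestrict _ (LinearMap.codRestrict _ (Submodule.subtype _) fun z =>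
      ⟨1, fun a ha => (Submodule.mem_torsionBySet_iff _ _).1 z.2 ⟨a, by simpa using ha⟩⟩) fun z =>
      (Submodule.mem_torsionBySet_iff _ _).2 fun a =>
        Subtype.ext ((Submodule.mem_torsionBySet_iff _ _).1 z.2 a)
  refine Module.length_le_of_injective φ fun z w h => Subtype.ext ?_
  have h1 : ((φ z : powTorsion (maximalIdeal R) A) : A) = (φ w : powTorsion (maximalIdeal R) A) := by
    rw [h]
  exact h1

end LocalCohomologyEquiv

section InitialIdeals

variable {R : Type} [CommRing R] {d : ℕ}

/-- The ideal generated by the first `j` members of a finite sequence. -/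
abbrev initialIdeal (x : Fin d → R) (j : ℕ) : Ideal R :=
  Ideal.span (x '' {k : Fin d | (k : ℕ) < j})

variable (x : Fin d → R)

lemma initialIdeal_zero : initialIdeal x 0 = ⊥ := by simp [initialIdeal]

lemma initialIdeal_of_le {j : ℕ} (h : d ≤ j) : initialIdeal x j = Ideal.span (Set.range x) := by
  have : {k : Fin d | (k : ℕ) < j} = Set.univ := by ext k; simp; omega
  rw [initialIdeal, this, Set.image_univ]

lemma initialIdeal_mono {i j : ℕ} (h : i ≤ j) : initialIdeal x i ≤ initialIdeal x j :=
  Ideal.span_mono (Set.image_mono fun k (hk : (k : ℕ) < i) => lt_of_lt_of_le hk h)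

lemma initialIdeal_le (j : ℕ) : initialIdeal x j ≤ Ideal.span (Set.range x) :=
  Ideal.span_mono (Set.image_subset_range _ _)

lemma initialIdeal_succ (k : Fin d) :
    initialIdeal x (k + 1) = initialIdeal x k ⊔ Ideal.span {x k} := by
  have : {l : Fin d | (l : ℕ) < k + 1} = {l : Fin d | (l : ℕ) < k} ∪ {k} := by
    ext l
    simp only [Set.mem_ofPred_eq, Set.mem_union, Set.mem_singleton_iff, Fin.ext_iff]
    omega
  rw [initialIdeal, this, Set.image_union, Ideal.span_union, Set.image_singleton]

lemma mem_initialIdeal_succ {k : Fin d} {a : R} :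
    a ∈ initialIdeal x (k + 1) ↔ ∃ c, a - x k * c ∈ initialIdeal x k := by
  rw [initialIdeal_succ, Submodule.mem_sup]
  constructor
  · rintro ⟨b, hb, c, hc, rfl⟩
    obtain ⟨c, rfl⟩ := Ideal.mem_span_singleton.1 hc
    exact ⟨c, by simpa using hb⟩
  · rintro ⟨c, hc⟩
    exact ⟨_, hc, _, Ideal.mul_mem_right c _ (Ideal.mem_span_singleton_self _), by ring⟩

end InitialIdeals

section Standard

variable {R : Type} [CommRing R] [IsNoetherianRing R] [IsLocalRing R] {d : ℕ} {x : Fin d → R}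

lemma ker_lsmul_initialIdeal_le_powTorsion
    (hrad : (Ideal.span (Set.range x)).radical = maximalIdeal R)
    (hx : ∀ i j : ℕ, i + j < d → ∀ a ∈ Ideal.span (Set.range x),
      ∀ v : LC (maximalIdeal R) i (R ⧸ initialIdeal x j), a • v = 0) (k : Fin d) :
    LinearMap.ker (LinearMap.lsmul R (R ⧸ initialIdeal x k) (x k)) ≤
      powTorsion (maximalIdeal R) (R ⧸ initialIdeal x k) := by
  obtain ⟨n, hn⟩ := Ideal.exists_pow_le_of_le_radical_of_fg hrad.ge (IsNoetherian.noetherian _)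
  refine ker_lsmul_le_powTorsion (t := d - k - 1) (s := x '' {l | (k : ℕ) + 1 ≤ l}) _
    (Set.toFinite _) ?_ ?_ ?_ ?_
  · rintro _ ⟨l, -, rfl⟩
    rw [← hrad]
    exact Ideal.le_radical (Ideal.subset_span ⟨l, rfl⟩)
  · refine (Set.ncard_image_le (Set.toFinite _)).trans ?_
    have : {l : Fin d | (k : ℕ) + 1 ≤ l} = ((Finset.Ioi k : Finset (Fin d)) : Set (Fin d)) := by
      ext l
      rw [Finset.coe_Ioi, Set.mem_Ioi, Fin.lt_def]
      exact Nat.succ_le_iff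
    rw [this, Set.ncard_coe_finset, Fin.card_Ioi]
    omega
  · rw [← initialIdeal_succ, initialIdeal, ← Ideal.span_union, ← Set.image_union]
    have : {l : Fin d | (l : ℕ) < k + 1} ∪ {l | (k : ℕ) + 1 ≤ l} = Set.univ := by
      ext l
      simp only [Set.mem_union, Set.mem_ofPred_eq, Set.mem_univ, iff_true]
      omega
    rw [this, Set.image_univ, hrad]
  · exact fun i hi => ⟨n, fun a ha => Module.mem_annihilator.2
      (hx (i + 1) k (by omega) a (hn ha))⟩

lemma socleLength_LC_initialIdeal_succ_le
    (hrad : (Ideal.span (Set.range x)).radical = maximalIdeal R)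
    (hx : ∀ i j : ℕ, i + j < d → ∀ a ∈ Ideal.span (Set.range x),
      ∀ v : LC (maximalIdeal R) i (R ⧸ initialIdeal x j), a • v = 0) {i : ℕ} (k : Fin d)
    (hik : i + k < d) :
    socleLength R (LC (maximalIdeal R) i (R ⧸ initialIdeal x (k + 1))) ≤
      socleLength R (LC (maximalIdeal R) i (R ⧸ initialIdeal x k)) +
      socleLength R (LC (maximalIdeal R) (i + 1) (R ⧸ initialIdeal x k)) := by
  refine socleLength_LC_le_add (p := Submodule.factor (initialIdeal_mono x (Nat.le_succ k)))
    (Submodule.factor_surjective _) ?_ _ (ker_lsmul_initialIdeal_le_powTorsion hrad hx k) i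
    (hx i k hik (x k) (Ideal.subset_span ⟨k, rfl⟩))
  intro z
  obtain ⟨a, rfl⟩ := Submodule.Quotient.mk_surjective _ z
  rw [Submodule.factor, Submodule.mapQ_apply, LinearMap.id_apply, Submodule.Quotient.mk_eq_zero, Nat.succ_eq_add_one,
    mem_initialIdeal_succ]
  constructor
  · rintro ⟨c, hc⟩
    exact ⟨Submodule.Quotient.mk c, ((Submodule.Quotient.eq _).2 hc).symm⟩
  · rintro ⟨c, hc⟩
    obtain ⟨c, rfl⟩ := Submodule.Quotient.mk_surjective _ c
    exact ⟨c, (Submodule.Quotient.eq _).1 hc.symm⟩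

lemma sum_choose_add_sum_choose (r : ℕ → ℕ) (i j : ℕ) :
    ∑ l ∈ Finset.range (j + 1), j.choose l * r (i + l) +
      ∑ l ∈ Finset.range (j + 1), j.choose l * r (i + 1 + l) =
      ∑ l ∈ Finset.range (j + 1 + 1), (j + 1).choose l * r (i + l) := by
  have h1 : ∑ l ∈ Finset.range (j + 1), j.choose l * r (i + l) =
      ∑ l ∈ Finset.range (j + 1), j.choose (l + 1) * r (i + 1 + l) + r i := by
    have := Finset.sum_range_succ (fun l => j.choose l * r (i + l)) (j + 1)
    rw [Finset.sum_range_succ'] at this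
    simp only [Nat.choose_succ_self, zero_mul, add_zero, Nat.choose_zero_right, one_mul] at this
    rw [← this]
    simp only [add_assoc, add_comm 1]
  have h2 : ∑ l ∈ Finset.range (j + 1 + 1), (j + 1).choose l * r (i + l) =
      ∑ l ∈ Finset.range (j + 1), (j.choose l + j.choose (l + 1)) * r (i + 1 + l) + r i := by
    rw [Finset.sum_range_succ']
    simp only [Nat.choose_succ_succ', Nat.choose_zero_right, one_mul, add_zero, add_assoc,
      add_comm 1]
  rw [h1, h2]
  simp only [add_mul, Finset.sum_add_distrib]
  ring

theorem socleLength_LC_initialIdeal_le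
    (hrad : (Ideal.span (Set.range x)).radical = maximalIdeal R)
    (hx : ∀ i j : ℕ, i + j < d → ∀ a ∈ Ideal.span (Set.range x),
      ∀ v : LC (maximalIdeal R) i (R ⧸ initialIdeal x j), a • v = 0) {r : ℕ → ℕ}
    (hr : ∀ i, socleLength R (LC (maximalIdeal R) i R) = r i) (j : ℕ) :
    ∀ i, i + j ≤ d → socleLength R (LC (maximalIdeal R) i (R ⧸ initialIdeal x j)) ≤
      ((∑ l ∈ Finset.range (j + 1), j.choose l * r (i + l) : ℕ) : ℕ∞) := by
  induction j with
  | zero =>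
    intro i _
    rw [(LC.mapEquiv (maximalIdeal R) i
      (Submodule.quotEquivOfEqBot _ (initialIdeal_zero x))).socleLength_eq, hr]
    simp
  | succ j ih =>
    intro i hi
    rw [← sum_choose_add_sum_choose, Nat.cast_add]
    exact (socleLength_LC_initialIdeal_succ_le hrad hx ⟨j, by omega⟩
      (show i + j < d by omega)).trans (add_le_add (ih _ (by omega)) (ih _ (by omega)))

end Standard

section RelativeLength

variable {R M : Type} [CommRing R] [AddCommGroup M] [Module R M]

/-- The length of `(A + B) / A`. -/
def relLength (A B : Submodule R M) : ℕ∞ := Module.length R (B.map A.mkQ)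

lemma relLength_eq_length_range {N : Type} [AddCommGroup N] [Module R N] {A B : Submodule R M}
    (φ : B →ₗ[R] N) (h : ∀ b : B, φ b = 0 ↔ (b : M) ∈ A) :
    relLength A B = Module.length R (LinearMap.range φ) := by
  have h1 : LinearMap.range (A.mkQ ∘ₗ B.subtype) = B.map A.mkQ := by
    rw [LinearMap.range_comp, Submodule.range_subtype]
  have h2 : LinearMap.ker (A.mkQ ∘ₗ B.subtype) = LinearMap.ker φ := by
    ext b
    rw [LinearMap.mem_ker, LinearMap.mem_ker, h]
    simp
  rw [relLength, ← h1]
  exact ((A.mkQ ∘ₗ B.subtype).quotKerEquivRange.symm ≪≫ₗ Submodule.quotEquivOfEq _ _ h2 ≪≫ₗ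
    φ.quotKerEquivRange).length_eq

lemma length_quotient_comap_subtype (A B : Submodule R M) :
    Module.length R (B ⧸ A.comap B.subtype) = relLength A B := by
  rw [relLength_eq_length_range (A := A) (B := B) (A.comap B.subtype).mkQ (fun b => by simp),
    Submodule.range_mkQ, Module.length_top]

lemma length_quotient_eq_relLength (A : Submodule R M) : Module.length R (M ⧸ A) = relLength A ⊤ := by
  rw [relLength, Submodule.map_top, Submodule.range_mkQ, Module.length_top]

lemma relLength_mono_right (A : Submodule R M) {B C : Submodule R M} (h : B ≤ C) :
    relLength A B ≤ relLength A C :=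
  Module.length_le_of_injective _ (Submodule.inclusion_injective (Submodule.map_mono h))

lemma relLength_eq_zero {A B : Submodule R M} (h : B ≤ A) : relLength A B = 0 := by
  rw [relLength, Module.length_eq_zero_iff, Submodule.subsingleton_iff_eq_bot,
    eq_bot_iff, Submodule.map_le_iff_le_comap]
  intro b hb
  simpa using h hb

/-- Comparison of relative lengths along multiplication by a ring element. -/
lemma relLength_le_of_smul {A B A' B' : Submodule R M} (x : R)
    (h1 : ∀ b ∈ B, ∃ c ∈ B', b - x • c ∈ A) (h2 : ∀ c ∈ B', c ∈ A' → x • c ∈ A) :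
    relLength A B ≤ relLength A' B' := by
  let ψ : B' →ₗ[R] M ⧸ A := A.mkQ ∘ₗ LinearMap.lsmul R M x ∘ₗ B'.subtype
  have h3 : B.map A.mkQ ≤ LinearMap.range ψ := by
    rintro _ ⟨b, hb, rfl⟩
    obtain ⟨c, hc, hbc⟩ := h1 b hb
    exact ⟨⟨c, hc⟩, ((Submodule.Quotient.eq _).2 hbc).symm⟩
  have h4 : A'.comap B'.subtype ≤ LinearMap.ker ψ :=
    fun c hc => (Submodule.Quotient.mk_eq_zero _).2 (h2 c c.2 hc)
  rw [← length_quotient_comap_subtype A' B']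
  refine (Module.length_le_of_injective _ (Submodule.inclusion_injective h3)).trans ?_
  refine Module.length_le_of_surjective
    ((A'.comap B'.subtype).liftQ ψ.rangeRestrict (by rwa [LinearMap.ker_rangeRestrict])) ?_
  rw [← LinearMap.range_eq_top, Submodule.range_liftQ, LinearMap.range_rangeRestrict]

lemma relLength_le_of_smul_mem {A B A' B' : Submodule R M} (x : R)
    (h1 : ∀ c ∈ B', x • c ∈ B) (h2 : ∀ c ∈ B', x • c ∈ A → c ∈ A') :
    relLength A' B' ≤ relLength A B := by
  let ψ : B' →ₗ[R] M ⧸ A := A.mkQ ∘ₗ LinearMap.lsmul R M x ∘ₗ B'.subtype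
  have h3 : LinearMap.range ψ ≤ B.map A.mkQ := by
    rintro _ ⟨c, rfl⟩
    exact ⟨x • c, h1 c c.2, rfl⟩
  have h4 : LinearMap.ker ψ ≤ A'.comap B'.subtype :=
    fun c hc => h2 c c.2 ((Submodule.Quotient.mk_eq_zero _).1 hc)
  rw [← length_quotient_comap_subtype A' B']
  refine le_trans ?_ (Module.length_le_of_injective _ (Submodule.inclusion_injective h3))
  refine (Module.length_le_of_surjective (Submodule.factor h4) (Submodule.factor_surjective h4)).trans
    ψ.quotKerEquivRange.length_eq.le

lemma relLength_add {A A' : Submodule R M} (h : A ≤ A') (B : Submodule R M) :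
    relLength A B = relLength A (B ⊓ A') + relLength A' B := by
  let g : B.map A.mkQ →ₗ[R] B.map A'.mkQ := (Submodule.factor h).restrict (by
    rintro _ ⟨b, hb, rfl⟩
    exact ⟨b, hb, rfl⟩)
  refine Module.length_eq_add_of_exact
    (Submodule.inclusion (Submodule.map_mono (f := A.mkQ) (inf_le_left : B ⊓ A' ≤ B))) g
    (Submodule.inclusion_injective _) ?_ ?_
  · rintro ⟨_, b, hb, rfl⟩
    exact ⟨⟨A.mkQ b, b, hb, rfl⟩, rfl⟩
  · rintro ⟨_, b, hb, rfl⟩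
    constructor
    · intro hz
      have hb' : b ∈ A' := (Submodule.Quotient.mk_eq_zero _).1 (congrArg Subtype.val hz)
      exact ⟨⟨A.mkQ b, b, ⟨hb, hb'⟩, rfl⟩, rfl⟩
    · rintro ⟨⟨_, c, hc, rfl⟩, hcb⟩
      have h1 : A.mkQ c = A.mkQ b := congrArg Subtype.val hcb
      have h2 : b - c ∈ A := (Submodule.Quotient.eq _).1 h1.symm
      refine Subtype.ext ((Submodule.Quotient.mk_eq_zero _).2 ?_)
      rw [← sub_add_cancel b c]
      exact A'.add_mem (h h2) hc.2

lemma relLength_anti_left {A A' : Submodule R M} (h : A ≤ A') (B : Submodule R M) :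
    relLength A' B ≤ relLength A B := by
  rw [relLength_add h]
  exact le_add_self

end RelativeLength

section SocleColon

variable {R : Type} [CommRing R]

lemma mem_colon_ideal {I J : Ideal R} {a : R} : a ∈ I.colon (J : Set R) ↔ ∀ b ∈ J, b * a ∈ I := by
  rw [Submodule.mem_colon]
  exact forall₂_congr fun b _ => by rw [smul_eq_mul, mul_comm]

lemma relLength_colon_maximalIdeal [IsLocalRing R] (A : Ideal R) :
    relLength A (A.colon (maximalIdeal R : Set R)) = socleLength R (R ⧸ A) := by
  have : Submodule.map A.mkQ (A.colon (maximalIdeal R : Set R)) =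
      Submodule.torsionBySet R (R ⧸ A) (maximalIdeal R : Set R) := by
    ext z
    obtain ⟨a, rfl⟩ := Submodule.Quotient.mk_surjective _ z
    rw [Submodule.mem_torsionBySet_iff]
    constructor
    · rintro ⟨b, hb, hba⟩ m
      rw [← hba]
      exact (Submodule.Quotient.mk_eq_zero _).2 (mem_colon_ideal.1 hb m m.2)
    · intro h
      refine ⟨a, mem_colon_ideal.2 fun b hb => ?_, rfl⟩
      exact (Submodule.Quotient.mk_eq_zero _).1 (h ⟨b, hb⟩)
  rw [relLength, this, socleLength]

end SocleColon

section SaturatedSequence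

variable {R : Type} [CommRing R] {d : ℕ}

/-- A finite sequence `x` such that, with `q` the ideal it generates and `J k` the ideal generated
by its first `k` members, `J k : x k = J k : q` and `x k` is regular modulo `J k : q`. -/
structure IsSaturatedSeq (x : Fin d → R) : Prop where
  mul_mem {k : Fin d} {a : R} : x k * a ∈ initialIdeal x k →
    ∀ b ∈ Ideal.span (Set.range x), b * a ∈ initialIdeal x k
  mul_mem_of_mul_mem {k : Fin d} {a : R} :
    (∀ b ∈ Ideal.span (Set.range x), b * (x k * a) ∈ initialIdeal x k) →
      ∀ b ∈ Ideal.span (Set.range x), b * a ∈ initialIdeal x k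

variable [IsLocalRing R] {x : Fin d → R}

lemma mul_mem_initialIdeal_of_mem_powTorsion
    (hx : ∀ i j : ℕ, i + j < d → ∀ a ∈ Ideal.span (Set.range x),
      ∀ v : LC (maximalIdeal R) i (R ⧸ initialIdeal x j), a • v = 0) {j : ℕ} (hj : j < d) {a : R}
    (ha : (Submodule.Quotient.mk a : R ⧸ initialIdeal x j) ∈
      powTorsion (maximalIdeal R) (R ⧸ initialIdeal x j)) {b : R}
    (hb : b ∈ Ideal.span (Set.range x)) : b * a ∈ initialIdeal x j :=
  (Submodule.Quotient.mk_eq_zero _).1 (smul_mem_torsion_eq_zero (hx 0 j (by omega) b hb) ha)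

lemma isSaturatedSeq_of_local_cohomology [IsNoetherianRing R]
    (hrad : (Ideal.span (Set.range x)).radical = maximalIdeal R)
    (hx : ∀ i j : ℕ, i + j < d → ∀ a ∈ Ideal.span (Set.range x),
      ∀ v : LC (maximalIdeal R) i (R ⧸ initialIdeal x j), a • v = 0) : IsSaturatedSeq x where
  mul_mem {k a} h b hb := mul_mem_initialIdeal_of_mem_powTorsion hx k.2
    (ker_lsmul_initialIdeal_le_powTorsion hrad hx k ((Submodule.Quotient.mk_eq_zero _).2 h)) hb
  mul_mem_of_mul_mem {k a} h b hb := by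
    obtain ⟨n, hn⟩ := Ideal.exists_pow_le_of_le_radical_of_fg hrad.ge (IsNoetherian.noetherian _)
    have h1 : ∀ b ∈ Ideal.span (Set.range x), b * a ∈
        (initialIdeal x k).colon (Ideal.span (Set.range x) : Set R) := by
      intro b hb
      rw [mem_colon_ideal]
      intro c hc
      refine mul_mem_initialIdeal_of_mem_powTorsion hx k.2
        (ker_lsmul_initialIdeal_le_powTorsion hrad hx k ((Submodule.Quotient.mk_eq_zero _).2 ?_)) hc
      beta_reduce
      rw [smul_eq_mul, mul_left_comm]
      exact h b hb
    refine mul_mem_initialIdeal_of_mem_powTorsion hx k.2 ⟨n * 2, fun c hc => ?_⟩ hb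
    refine (Submodule.Quotient.mk_eq_zero _).2 ?_
    rw [pow_mul] at hc
    have h2 := Ideal.pow_right_mono hn 2 hc
    rw [pow_two] at h2
    refine Submodule.mul_induction_on h2 (fun u hu v hv => ?_) (fun u v hu hv => ?_)
    · beta_reduce
      rw [smul_eq_mul, mul_assoc]
      exact mem_colon_ideal.1 (h1 v hv) u hu
    · beta_reduce at *
      rw [add_smul]
      exact Ideal.add_mem _ hu hv

end SaturatedSequence

section SaturatedColon

variable {R : Type} [CommRing R] {d : ℕ}

/-- The colon ideal of an initial ideal by the ideal generated by the whole sequence. -/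
abbrev saturatedIdeal (x : Fin d → R) (j : ℕ) : Ideal R :=
  (initialIdeal x j).colon (Ideal.span (Set.range x) : Set R)

variable {x : Fin d → R}

lemma initialIdeal_le_saturatedIdeal (j : ℕ) : initialIdeal x j ≤ saturatedIdeal x j :=
  fun _ ha => mem_colon_ideal.2 fun b _ => Ideal.mul_mem_left _ b ha

lemma saturatedIdeal_mono {i j : ℕ} (h : i ≤ j) : saturatedIdeal x i ≤ saturatedIdeal x j :=
  fun _ ha => mem_colon_ideal.2 fun b hb => initialIdeal_mono x h (mem_colon_ideal.1 ha b hb)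

lemma IsSaturatedSeq.mem_saturatedIdeal (hx : IsSaturatedSeq x) {k : Fin d} {a : R} :
    a ∈ saturatedIdeal x k ↔ x k * a ∈ initialIdeal x k :=
  ⟨fun h => mem_colon_ideal.1 h _ (Ideal.subset_span ⟨k, rfl⟩),
    fun h => mem_colon_ideal.2 (hx.mul_mem h)⟩

lemma IsSaturatedSeq.mem_of_mul_mem (hx : IsSaturatedSeq x) {k : Fin d} {a : R}
    (h : x k * a ∈ saturatedIdeal x k) : a ∈ saturatedIdeal x k :=
  mem_colon_ideal.2 (hx.mul_mem_of_mul_mem (mem_colon_ideal.1 h))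

variable [IsNoetherianRing R] [IsLocalRing R]

theorem socleLength_quotient_saturatedIdeal_sup_le
    (hrad : (Ideal.span (Set.range x)).radical = maximalIdeal R)
    (hx : ∀ i j : ℕ, i + j < d → ∀ a ∈ Ideal.span (Set.range x),
      ∀ v : LC (maximalIdeal R) i (R ⧸ initialIdeal x j), a • v = 0) (k : Fin d) :
    socleLength R (R ⧸ (saturatedIdeal x k ⊔ Ideal.span {x k})) ≤
      socleLength R (LC (maximalIdeal R) 1 (R ⧸ initialIdeal x k)) := by
  have hsat := isSaturatedSeq_of_local_cohomology hrad hx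
  set J := initialIdeal x k
  set U := saturatedIdeal x k
  obtain ⟨n, hn⟩ := Ideal.exists_pow_le_of_le_radical_of_fg hrad.ge (IsNoetherian.noetherian _)
  have hker : LinearMap.ker (Submodule.factor (initialIdeal_le_saturatedIdeal (x := x) k)) ≤
      powTorsion (maximalIdeal R) (R ⧸ J) := by
    intro z hz
    obtain ⟨a, rfl⟩ := Submodule.Quotient.mk_surjective _ z
    have ha : a ∈ U := (Submodule.Quotient.mk_eq_zero _).1 hz
    exact ⟨n, fun b hb => (Submodule.Quotient.mk_eq_zero _).2 (mem_colon_ideal.1 ha b (hn hb))⟩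
  have htors : powTorsion (maximalIdeal R) (R ⧸ U) = ⊥ := by
    rw [eq_bot_iff]
    intro z
    obtain ⟨a, rfl⟩ := Submodule.Quotient.mk_surjective _ z
    rintro ⟨m, hm⟩
    refine (Submodule.Quotient.mk_eq_zero _).2 ?_
    have hxm : x k ^ m * a ∈ U := (Submodule.Quotient.mk_eq_zero _).1
      (hm _ (Ideal.pow_mem_pow (hrad ▸ Ideal.le_radical (Ideal.subset_span ⟨k, rfl⟩)) m))
    clear hm
    induction m with
    | zero => simpa using hxm
    | succ m ih =>
      refine ih (hsat.mem_of_mul_mem ?_)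
      rwa [← mul_assoc, ← pow_succ']
  have hinj : Function.Injective (LinearMap.lsmul R (R ⧸ U) (x k)) := by
    rw [injective_iff_map_eq_zero]
    intro z hz
    obtain ⟨a, rfl⟩ := Submodule.Quotient.mk_surjective _ z
    exact (Submodule.Quotient.mk_eq_zero _).2
      (hsat.mem_of_mul_mem ((Submodule.Quotient.mk_eq_zero _).1 hz))
  have hle : U ≤ U ⊔ Ideal.span {x k} := le_sup_left
  have hex : Function.Exact (LinearMap.lsmul R (R ⧸ U) (x k)) (Submodule.factor hle) := by
    intro z
    obtain ⟨a, rfl⟩ := Submodule.Quotient.mk_surjective _ z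
    rw [Submodule.factor, Submodule.mapQ_apply, LinearMap.id_apply, Submodule.Quotient.mk_eq_zero,
      Submodule.mem_sup]
    constructor
    · rintro ⟨u, hu, c, hc, rfl⟩
      obtain ⟨c, rfl⟩ := Ideal.mem_span_singleton.1 hc
      refine ⟨Submodule.Quotient.mk c, (Submodule.Quotient.eq _).2 ?_⟩
      simpa using hu
    · rintro ⟨c, hc⟩
      obtain ⟨c, rfl⟩ := Submodule.Quotient.mk_surjective _ c
      exact ⟨_, (Submodule.Quotient.eq _).1 hc.symm, _,
        Ideal.mul_mem_right c _ (Ideal.mem_span_singleton_self _), by simp⟩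
  obtain ⟨δ, h1, -⟩ := LC.exists_connecting (maximalIdeal R) 0 hinj hex
    (Submodule.factor_surjective hle)
  have := LC.zero_subsingleton (maximalIdeal R) htors
  have hδ : Function.Injective δ := by
    rw [injective_iff_map_eq_zero]
    intro z hz
    obtain ⟨w, rfl⟩ := (h1 z).1 hz
    rw [Subsingleton.elim w 0, map_zero]
  refine (socleLength_le_LC_zero R _).trans ((socleLength_le_of_injective hδ).trans ?_)
  exact (LinearEquiv.ofBijective _ (LC.map_bijective_of_ker_torsion (maximalIdeal R) 0
    (Submodule.factor_surjective _) hker)).symm.socleLength_eq.le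

end SaturatedColon

section SaturatedPowers

variable {R : Type} [CommRing R] {d : ℕ} {x : Fin d → R}

lemma exists_sub_mul_mem_of_mem_initialIdeal_succ_mul {k : Fin d} {T : Ideal R} {b : R}
    (hb : b ∈ initialIdeal x (k + 1) * T) : ∃ c ∈ T, b - x k * c ∈ initialIdeal x k * T := by
  rw [initialIdeal_succ, Submodule.sup_mul, Submodule.mem_sup] at hb
  obtain ⟨u, hu, v, hv, rfl⟩ := hb
  obtain ⟨c, hc, rfl⟩ := Ideal.mem_span_singleton_mul.1 hv
  exact ⟨c, hc, by simpa using hu⟩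

theorem IsSaturatedSeq.saturatedIdeal_inf_pow_le (hx : IsSaturatedSeq x) (m : ℕ) : ∀ j, j + m = d →
    ∀ n, saturatedIdeal x j ⊓ Ideal.span (Set.range x) ^ (n + 1) ≤
      initialIdeal x j * Ideal.span (Set.range x) ^ n := by
  induction m with
  | zero =>
    intro j hj n
    rw [initialIdeal_of_le x (by omega : d ≤ j), ← pow_succ']
    exact inf_le_right
  | succ m ih =>
    intro j hj n
    obtain ⟨k, rfl⟩ : ∃ k : Fin d, (k : ℕ) = j := ⟨⟨j, by omega⟩, rfl⟩
    have hstep : ∀ n, ∀ a ∈ saturatedIdeal x k ⊓ Ideal.span (Set.range x) ^ (n + 1),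
        ∃ b ∈ saturatedIdeal x k ⊓ Ideal.span (Set.range x) ^ n,
          a - x k * b ∈ initialIdeal x k * Ideal.span (Set.range x) ^ n := by
      rintro n a ⟨ha, han⟩
      obtain ⟨b, hb, hab⟩ := exists_sub_mul_mem_of_mem_initialIdeal_succ_mul
        (ih (k + 1) (by omega) n ⟨saturatedIdeal_mono (Nat.le_add_right k 1) ha, han⟩)
      refine ⟨b, ⟨hx.mem_of_mul_mem (k := k) ?_, hb⟩, hab⟩
      have h1 := initialIdeal_le_saturatedIdeal k (Ideal.mul_le_left hab)
      have h2 : x k * b = a - (a - x k * b) := by ring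
      rw [h2]
      exact Ideal.sub_mem _ ha h1
    induction n with
    | zero =>
      intro a ha
      obtain ⟨b, hb, hab⟩ := hstep 0 a ha
      rw [pow_zero, mul_one] at hab ⊢
      have h2 : a = (a - x k * b) + x k * b := by ring
      rw [h2]
      exact Ideal.add_mem _ hab (hx.mem_saturatedIdeal.1 hb.1)
    | succ n ihn =>
      intro a ha
      obtain ⟨b, hb, hab⟩ := hstep (n + 1) a ha
      have h2 : a = (a - x k * b) + x k * b := by ring
      rw [h2]
      refine Ideal.add_mem _ hab ?_
      rw [pow_succ', ← mul_assoc, mul_comm (initialIdeal x k), mul_assoc]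
      exact Ideal.mul_mem_mul (Ideal.subset_span ⟨k, rfl⟩) (ihn hb)

lemma IsSaturatedSeq.initialIdeal_inf_pow_le (hx : IsSaturatedSeq x) {j : ℕ} (hj : j ≤ d) (n : ℕ) :
    initialIdeal x j ⊓ Ideal.span (Set.range x) ^ (n + 1) ≤
      initialIdeal x j * Ideal.span (Set.range x) ^ n :=
  (inf_le_inf_right _ (initialIdeal_le_saturatedIdeal j)).trans
    (hx.saturatedIdeal_inf_pow_le (d - j) j (by omega) n)

lemma IsSaturatedSeq.exists_mem_saturatedIdeal_of_mul_mem (hx : IsSaturatedSeq x) {k : Fin d}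
    {n : ℕ} {c : R} (h : x k * c ∈ initialIdeal x k ⊔ Ideal.span (Set.range x) ^ (n + 1)) :
    ∃ b ∈ Ideal.span (Set.range x) ^ n, c - b ∈ saturatedIdeal x k := by
  obtain ⟨j, hj, w, hw, hjw⟩ := Submodule.mem_sup.1 h
  have h1 : w ∈ initialIdeal x (k + 1) := by
    have : w = x k * c - j := by rw [← hjw]; ring
    rw [this]
    refine Ideal.sub_mem _ ?_ (initialIdeal_mono x (Nat.le_add_right _ 1) hj)
    exact (mem_initialIdeal_succ x).2 ⟨c, by simp⟩
  obtain ⟨b, hb, hwb⟩ := exists_sub_mul_mem_of_mem_initialIdeal_succ_mul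
    (hx.initialIdeal_inf_pow_le (by omega : (k : ℕ) + 1 ≤ d) n ⟨h1, hw⟩)
  refine ⟨b, hb, hx.mem_saturatedIdeal.2 ?_⟩
  have : x k * (c - b) = j + (w - x k * b) := by linear_combination -hjw
  rw [this]
  exact Ideal.add_mem _ hj (Ideal.mul_le_left hwb)

variable (x) in
/-- The ideals filtering the powers of the ideal generated by a saturated sequence. -/
def filtrationIdeal (j : ℕ) : ℕ → Ideal R
  | 0 => saturatedIdeal x j ⊔ Ideal.span (Set.range x)
  | n + 1 => initialIdeal x j * Ideal.span (Set.range x) ^ n ⊔ Ideal.span (Set.range x) ^ (n + 2)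

lemma pow_succ_le_filtrationIdeal (j : ℕ) :
    ∀ n, Ideal.span (Set.range x) ^ (n + 1) ≤ filtrationIdeal x j n
  | 0 => by rw [zero_add, pow_one]; exact le_sup_right
  | _ + 1 => le_sup_right

lemma filtrationIdeal_mono {i j : ℕ} (h : i ≤ j) (n : ℕ) :
    filtrationIdeal x i (n + 1) ≤ filtrationIdeal x j (n + 1) :=
  sup_le_sup_right (Ideal.mul_mono_left (initialIdeal_mono x h)) _

lemma filtrationIdeal_zero_succ (n : ℕ) :
    filtrationIdeal x 0 (n + 1) = Ideal.span (Set.range x) ^ (n + 2) := by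
  rw [filtrationIdeal, initialIdeal_zero, Submodule.bot_mul, bot_sup_eq]

lemma pow_le_filtrationIdeal {j : ℕ} (h : d ≤ j) (n : ℕ) :
    Ideal.span (Set.range x) ^ (n + 1) ≤ filtrationIdeal x j (n + 1) := by
  rw [filtrationIdeal, initialIdeal_of_le x h, ← pow_succ']
  exact le_sup_left

lemma exists_sub_mul_mem_filtrationIdeal {k : Fin d} {n : ℕ} {b : R}
    (hb : b ∈ filtrationIdeal x (k + 1) (n + 1)) :
    ∃ c ∈ Ideal.span (Set.range x) ^ n, b - x k * c ∈ filtrationIdeal x k (n + 1) := by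
  obtain ⟨u, hu, v, hv, rfl⟩ := Submodule.mem_sup.1 hb
  obtain ⟨c, hc, huc⟩ := exists_sub_mul_mem_of_mem_initialIdeal_succ_mul hu
  refine ⟨c, hc, Submodule.mem_sup.2 ⟨_, huc, v, hv, by ring⟩⟩

lemma mul_mem_filtrationIdeal_succ {k : Fin d} {n : ℕ} {c : R}
    (hc : c ∈ Ideal.span (Set.range x) ^ n) : x k * c ∈ filtrationIdeal x (k + 1) (n + 1) :=
  Ideal.mem_sup_left (Ideal.mul_mem_mul
    (Ideal.subset_span ⟨k, show (k : ℕ) < k + 1 by omega, rfl⟩) hc)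

lemma IsSaturatedSeq.mul_mem_filtrationIdeal_iff (hx : IsSaturatedSeq x) {k : Fin d} {n : ℕ} {c : R}
    (hc : c ∈ Ideal.span (Set.range x) ^ n) :
    x k * c ∈ filtrationIdeal x k (n + 1) ↔ c ∈ filtrationIdeal x k n := by
  have hxk : x k ∈ Ideal.span (Set.range x) := Ideal.subset_span ⟨k, rfl⟩
  constructor
  · intro h
    obtain ⟨b, hb, hcb⟩ := hx.exists_mem_saturatedIdeal_of_mul_mem (n := n + 1)
      (sup_le_sup_right (c := Ideal.span (Set.range x) ^ (n + 2))
        (Ideal.mul_le_left (J := Ideal.span (Set.range x) ^ n)) h)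
    have h2 : c = (c - b) + b := by ring
    rw [h2]
    refine Ideal.add_mem _ ?_ (pow_succ_le_filtrationIdeal _ _ hb)
    cases n with
    | zero => exact Ideal.mem_sup_left hcb
    | succ n =>
      refine Ideal.mem_sup_left (hx.saturatedIdeal_inf_pow_le (d - k) k (by omega) n ⟨hcb, ?_⟩)
      exact Ideal.sub_mem _ hc (Ideal.pow_le_pow_right (Nat.le_add_right _ 1) hb)
  · intro h
    cases n with
    | zero =>
      obtain ⟨u, hu, v, hv, rfl⟩ := Submodule.mem_sup.1 h
      rw [mul_add]
      refine Ideal.add_mem _ (Ideal.mem_sup_left ?_) (Ideal.mem_sup_right ?_)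
      · rw [pow_zero, mul_one]
        exact hx.mem_saturatedIdeal.1 hu
      · rw [pow_two]
        exact Ideal.mul_mem_mul hxk hv
    | succ n =>
      obtain ⟨u, hu, v, hv, rfl⟩ := Submodule.mem_sup.1 h
      rw [mul_add]
      refine Ideal.add_mem _ (Ideal.mem_sup_left ?_) (Ideal.mem_sup_right ?_)
      · rw [pow_succ', ← mul_assoc, mul_comm (initialIdeal x k), mul_assoc]
        exact Ideal.mul_mem_mul hxk hu
      · rw [pow_succ']
        exact Ideal.mul_mem_mul hxk hv

end SaturatedPowers

section FiltrationLengths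

variable {R : Type} [CommRing R] {d : ℕ} {x : Fin d → R}

lemma IsSaturatedSeq.relLength_colon_inf_pow_succ_le [IsLocalRing R] (hx : IsSaturatedSeq x)
    (k : Fin d) (n : ℕ) :
    relLength (filtrationIdeal x k (n + 1))
        ((filtrationIdeal x k (n + 1)).colon (maximalIdeal R : Set R) ⊓
          Ideal.span (Set.range x) ^ (n + 1)) ≤
      relLength (filtrationIdeal x k n)
        ((filtrationIdeal x k n).colon (maximalIdeal R : Set R) ⊓ Ideal.span (Set.range x) ^ n) +
      relLength (filtrationIdeal x (k + 1) (n + 1))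
        ((filtrationIdeal x (k + 1) (n + 1)).colon (maximalIdeal R : Set R) ⊓
          Ideal.span (Set.range x) ^ (n + 1)) := by
  rw [relLength_add (A := filtrationIdeal x k (n + 1)) (A' := filtrationIdeal x (k + 1) (n + 1))
    (filtrationIdeal_mono (Nat.le_add_right k 1) n)]
  refine add_le_add (relLength_le_of_smul (x k) ?_ ?_) (relLength_mono_right _
    (inf_le_inf_right _ fun a ha => mem_colon_ideal.2 fun b hb =>
      filtrationIdeal_mono (Nat.le_add_right k 1) n (mem_colon_ideal.1 ha b hb)))
  · rintro b ⟨⟨hb, -⟩, hb'⟩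
    obtain ⟨c, hc, hbc⟩ := exists_sub_mul_mem_filtrationIdeal hb'
    refine ⟨c, ⟨mem_colon_ideal.2 fun m hm => ?_, hc⟩, hbc⟩
    rw [← hx.mul_mem_filtrationIdeal_iff (Ideal.mul_mem_left _ m hc)]
    have : x k * (m * c) = m * b - m * (b - x k * c) := by ring
    rw [this]
    exact Ideal.sub_mem _ (mem_colon_ideal.1 hb m hm) (Ideal.mul_mem_left _ _ hbc)
  · rintro c ⟨-, hc⟩ hc'
    exact (hx.mul_mem_filtrationIdeal_iff hc).2 hc'

lemma IsSaturatedSeq.le_relLength_pow_succ_mul (hx : IsSaturatedSeq x) (I : Ideal R)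
    (k : Fin d) (n : ℕ) :
    relLength (filtrationIdeal x k n) (Ideal.span (Set.range x) ^ n * I) +
      relLength (filtrationIdeal x (k + 1) (n + 1)) (Ideal.span (Set.range x) ^ (n + 1) * I) ≤
      relLength (filtrationIdeal x k (n + 1)) (Ideal.span (Set.range x) ^ (n + 1) * I) := by
  rw [relLength_add (A := filtrationIdeal x k (n + 1)) (A' := filtrationIdeal x (k + 1) (n + 1))
    (filtrationIdeal_mono (Nat.le_add_right k 1) n)]
  refine add_le_add (relLength_le_of_smul_mem (x k) ?_ ?_) le_rfl
  · refine fun c hc => ⟨?_, mul_mem_filtrationIdeal_succ (Ideal.mul_le_left hc)⟩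
    rw [pow_succ', mul_assoc]
    exact Ideal.mul_mem_mul (Ideal.subset_span ⟨k, rfl⟩) hc
  · exact fun c hc h => (hx.mul_mem_filtrationIdeal_iff (Ideal.mul_le_left hc)).1 h

end FiltrationLengths

section PascalBounds

lemma le_of_pascal_le {s c : ℕ∞} {D : ℕ} {a : ℕ → ℕ → ℕ∞} (h0 : ∀ n, a 0 n ≤ s)
    (hc : ∀ m ≤ D, a m 0 ≤ c) (h : ∀ m < D, ∀ n, a (m + 1) (n + 1) ≤ a (m + 1) n + a m (n + 1))
    (m : ℕ) : m < D → ∀ n, a (m + 1) n ≤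
      s * ((n + m + 1).choose (m + 1) : ℕ) + c * ((n + m + 1).choose m : ℕ) := by
  induction m with
  | zero =>
    intro hD n
    induction n with
    | zero =>
      refine (hc 1 hD).trans ?_
      simp
    | succ n ih =>
      refine (h 0 hD n).trans ((add_le_add ih (h0 _)).trans (le_of_eq ?_))
      simp only [Nat.choose_zero_right, Nat.choose_one_right, zero_add, add_zero]
      push_cast
      ring
  | succ m ihm =>
    intro hD n
    induction n with
    | zero =>
      refine (hc (m + 1 + 1) hD).trans (le_add_left (le_mul_of_one_le_right' ?_))
      exact_mod_cast Nat.choose_pos (by omega)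
    | succ n ih =>
      refine (h (m + 1) hD n).trans ((add_le_add ih (ihm (by omega) (n + 1))).trans (le_of_eq ?_))
      have h1 : n + 1 + m + 1 = n + (m + 1) + 1 := by omega
      rw [h1, show n + 1 + (m + 1) + 1 = n + (m + 1) + 1 + 1 by omega,
        Nat.choose_succ_succ' (n + (m + 1) + 1) (m + 1), Nat.choose_succ_succ' (n + (m + 1) + 1) m]
      push_cast
      ring

lemma le_of_le_pascal {s : ℕ∞} {D : ℕ} {a : ℕ → ℕ → ℕ∞} (h0 : ∀ n, s ≤ a 0 n)
    (hc : ∀ m ≤ D, s ≤ a m 0) (h : ∀ m < D, ∀ n, a (m + 1) n + a m (n + 1) ≤ a (m + 1) (n + 1))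
    (m : ℕ) : m ≤ D → ∀ n, s * ((n + m).choose m : ℕ) ≤ a m n := by
  induction m with
  | zero => intro _ n; simpa using h0 n
  | succ m ihm =>
    intro hD n
    induction n with
    | zero => simpa using hc (m + 1) hD
    | succ n ih =>
      refine le_trans (le_of_eq ?_) ((add_le_add ih (ihm (by omega) (n + 1))).trans (h m hD n))
      rw [show n + 1 + m = n + m + 1 by omega, show n + 1 + (m + 1) = n + m + 1 + 1 by omega,
        Nat.choose_succ_succ' _ m, ← add_assoc n m 1]
      push_cast
      ring

end PascalBounds

section LengthBounds

variable {R : Type} [CommRing R] {e : ℕ} {x : Fin (e + 2) → R}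

theorem IsSaturatedSeq.relLength_mul_choose_le (hx : IsSaturatedSeq x) (I : Ideal R) (n : ℕ) :
    relLength (filtrationIdeal x (e + 1) 0) I * ((n + 1 + (e + 1)).choose (e + 1) : ℕ) ≤
      relLength (Ideal.span (Set.range x) ^ (n + 2)) (Ideal.span (Set.range x) ^ (n + 1) * I) := by
  have h := le_of_le_pascal (D := e + 1) (s := relLength (filtrationIdeal x (e + 1) 0) I)
    (a := fun m n => relLength (filtrationIdeal x (e + 1 - m) n) (Ideal.span (Set.range x) ^ n * I))
    ?_ ?_ ?_ (e + 1) le_rfl (n + 1)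
  · simpa only [Nat.sub_self, filtrationIdeal_zero_succ] using h
  · intro n
    induction n with
    | zero => simp
    | succ n ih =>
      exact ih.trans (le_self_add.trans
        (hx.le_relLength_pow_succ_mul I ⟨e + 1, by omega⟩ n))
  · intro m _
    rw [pow_zero, Ideal.one_eq_top, Ideal.top_mul]
    exact relLength_anti_left (sup_le_sup_right (saturatedIdeal_mono (by omega)) _) _
  · intro m hm n
    have := hx.le_relLength_pow_succ_mul I ⟨e + 1 - (m + 1), by omega⟩ n
    rwa [show ((⟨e + 1 - (m + 1), by omega⟩ : Fin (e + 2)) : ℕ) + 1 = e + 1 - m by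
      simp only; omega] at this

theorem IsSaturatedSeq.relLength_colon_pow_le [IsLocalRing R] (hx : IsSaturatedSeq x)
    (hq : Ideal.span (Set.range x) ≤ maximalIdeal R) (n : ℕ) :
    relLength (Ideal.span (Set.range x) ^ (n + 2))
        ((Ideal.span (Set.range x) ^ (n + 2)).colon (maximalIdeal R : Set R)) ≤
      socleLength R (R ⧸ filtrationIdeal x (e + 1) 0) * ((n + 1 + e + 1).choose (e + 1) : ℕ) +
        Module.length R (R ⧸ Ideal.span (Set.range x)) * ((n + 1 + e + 1).choose e : ℕ) +
        Module.length R (R ⧸ Ideal.span (Set.range x)) := by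
  rw [length_quotient_eq_relLength, relLength_add (A' := Ideal.span (Set.range x) ^ (n + 1))
    (Ideal.pow_le_pow_right (by omega))]
  refine add_le_add ?_ ?_
  · have h := le_of_pascal_le (D := e + 1) (s := socleLength R (R ⧸ filtrationIdeal x (e + 1) 0))
      (c := relLength (Ideal.span (Set.range x)) ⊤)
      (a := fun m n => relLength (filtrationIdeal x (e + 1 - m) n)
        ((filtrationIdeal x (e + 1 - m) n).colon (maximalIdeal R : Set R) ⊓
          Ideal.span (Set.range x) ^ n)) ?_ ?_ ?_ e (by omega) (n + 1)
    · simpa only [Nat.sub_self, filtrationIdeal_zero_succ] using h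
    · intro n
      induction n with
      | zero =>
        rw [← relLength_colon_maximalIdeal]
        exact relLength_mono_right _ inf_le_left
      | succ n ih =>
        refine (hx.relLength_colon_inf_pow_succ_le ⟨e + 1, by omega⟩ n).trans ?_
        rw [relLength_eq_zero (A := filtrationIdeal x (_ + 1) (n + 1))
          (inf_le_right.trans (pow_le_filtrationIdeal (by simp) n)), add_zero]
        exact ih
    · intro m _
      exact (relLength_anti_left le_sup_right _).trans (relLength_mono_right _ le_top)
    · intro m hm n
      have := hx.relLength_colon_inf_pow_succ_le ⟨e + 1 - (m + 1), by omega⟩ n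
      rwa [show ((⟨e + 1 - (m + 1), by omega⟩ : Fin (e + 2)) : ℕ) + 1 = e + 1 - m by
        simp only; omega] at this
  · refine (relLength_le_of_smul (A' := Ideal.span (Set.range x)) (B' := saturatedIdeal x 0) 1
      ?_ ?_).trans (relLength_mono_right _ le_top)
    · intro b hb
      have h1 := mem_colon_ideal.1 hb (x 0) (hq (Ideal.subset_span ⟨0, rfl⟩))
      obtain ⟨c, hc, hbc⟩ := hx.exists_mem_saturatedIdeal_of_mul_mem (k := 0) (n := n + 1)
        (Ideal.mem_sup_right h1)
      exact ⟨b - c, hbc, by simpa using hc⟩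
    · intro c hc hcq
      have h1 := hx.saturatedIdeal_inf_pow_le (e + 2) 0 (by omega) 0 ⟨hc, by simpa using hcq⟩
      rw [initialIdeal_zero, Submodule.bot_mul, Submodule.mem_bot] at h1
      rw [h1, smul_zero]
      exact Submodule.zero_mem _

end LengthBounds

section SocleOfParameterIdeal

variable {R : Type} [CommRing R] {e : ℕ} {x : Fin (e + 2) → R}

lemma filtrationIdeal_last_zero :
    filtrationIdeal x (e + 1) 0 = saturatedIdeal x (e + 1) ⊔ Ideal.span {x ⟨e + 1, by omega⟩} := by
  have h := initialIdeal_succ x ⟨e + 1, by omega⟩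
  rw [initialIdeal_of_le x (by simp)] at h
  have h2 : saturatedIdeal x (e + 1) ⊔ initialIdeal x (e + 1) = saturatedIdeal x (e + 1) :=
    sup_eq_left.2 (initialIdeal_le_saturatedIdeal _)
  rw [filtrationIdeal, h, ← sup_assoc, h2]

variable [IsNoetherianRing R] [IsLocalRing R]

lemma socleLength_quotient_filtrationIdeal_le
    (hrad : (Ideal.span (Set.range x)).radical = maximalIdeal R)
    (hx : ∀ i j : ℕ, i + j < e + 2 → ∀ a ∈ Ideal.span (Set.range x),
      ∀ v : LC (maximalIdeal R) i (R ⧸ initialIdeal x j), a • v = 0)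
    {r : ℕ → ℕ} (hr : ∀ i, socleLength R (LC (maximalIdeal R) i R) = r i) :
    socleLength R (R ⧸ filtrationIdeal x (e + 1) 0) ≤
      ((∑ l ∈ Finset.range (e + 2), (e + 1).choose l * r (1 + l) : ℕ) : ℕ∞) := by
  rw [filtrationIdeal_last_zero]
  exact (socleLength_quotient_saturatedIdeal_sup_le hrad hx ⟨e + 1, by omega⟩).trans
    (socleLength_LC_initialIdeal_le hrad hx hr (e + 1) 1 (by omega))

lemma relLength_colon_inf_filtrationIdeal_le
    (hrad : (Ideal.span (Set.range x)).radical = maximalIdeal R)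
    (hx : ∀ i j : ℕ, i + j < e + 2 → ∀ a ∈ Ideal.span (Set.range x),
      ∀ v : LC (maximalIdeal R) i (R ⧸ initialIdeal x j), a • v = 0)
    {r : ℕ → ℕ} (hr : ∀ i, socleLength R (LC (maximalIdeal R) i R) = r i) :
    relLength (Ideal.span (Set.range x)) ((Ideal.span (Set.range x)).colon (maximalIdeal R : Set R) ⊓
      filtrationIdeal x (e + 1) 0) ≤
      ((∑ l ∈ Finset.range (e + 2), (e + 1).choose l * r l : ℕ) : ℕ∞) := by
  have hsat := isSaturatedSeq_of_local_cohomology hrad hx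
  have h1 : relLength (Ideal.span (Set.range x))
      ((Ideal.span (Set.range x)).colon (maximalIdeal R : Set R) ⊓ filtrationIdeal x (e + 1) 0) ≤
      relLength (initialIdeal x (e + 1)) ((initialIdeal x (e + 1)).colon (maximalIdeal R : Set R)) := by
    refine relLength_le_of_smul 1 ?_ ?_
    · rintro a ⟨ha, haU⟩
      obtain ⟨u, hu, v, hv, rfl⟩ := Submodule.mem_sup.1 haU
      refine ⟨u, mem_colon_ideal.2 fun b hb => ?_, by simpa using hv⟩
      have h2 : b * u ∈ Ideal.span (Set.range x) := by
        have h3 : b * u = b * (u + v) - b * v := by ring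
        rw [h3]
        exact Ideal.sub_mem _ (mem_colon_ideal.1 ha b hb) (Ideal.mul_mem_left _ _ hv)
      have h4 := hsat.saturatedIdeal_inf_pow_le 1 (e + 1) rfl 0
        ⟨Ideal.mul_mem_left _ b hu, by simpa using h2⟩
      simpa using h4
    · intro c _ hc
      rw [one_smul]
      exact initialIdeal_le x _ hc
  refine h1.trans ?_
  rw [relLength_colon_maximalIdeal]
  refine (socleLength_le_LC_zero R _).trans ?_
  simpa using socleLength_LC_initialIdeal_le hrad hx hr (e + 1) 0 (by omega)

lemma le_relLength_filtrationIdeal_colon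
    (hrad : (Ideal.span (Set.range x)).radical = maximalIdeal R)
    (hx : ∀ i j : ℕ, i + j < e + 2 → ∀ a ∈ Ideal.span (Set.range x),
      ∀ v : LC (maximalIdeal R) i (R ⧸ initialIdeal x j), a • v = 0)
    {r : ℕ → ℕ} (hr : ∀ i, socleLength R (LC (maximalIdeal R) i R) = r i)
    (hN : ((∑ i ∈ Finset.range (e + 3), (e + 2).choose i * r i : ℕ) : ℕ∞) ≤
      relLength (Ideal.span (Set.range x))
        ((Ideal.span (Set.range x)).colon (maximalIdeal R : Set R))) :
    ((∑ l ∈ Finset.range (e + 2), (e + 1).choose l * r (1 + l) : ℕ) : ℕ∞) ≤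
      relLength (filtrationIdeal x (e + 1) 0)
        ((Ideal.span (Set.range x)).colon (maximalIdeal R : Set R)) := by
  have h1 := sum_choose_add_sum_choose r 0 (e + 1)
  simp only [zero_add] at h1
  rw [← h1, relLength_add (A' := filtrationIdeal x (e + 1) 0) le_sup_right] at hN
  have h2 := hN.trans
    (add_le_add_left (relLength_colon_inf_filtrationIdeal_le hrad hx hr) _)
  push_cast at h2 ⊢
  exact (ENat.add_le_add_iff_left (by exact_mod_cast ENat.natCast_ne_top _)).1 h2

end SocleOfParameterIdeal

section BinomialAsymptotics

open Filter Topology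

lemma tendsto_choose_div_pow (b k : ℕ) :
    Tendsto (fun n : ℕ => ((n + b).choose k : ℝ) / (n : ℝ) ^ k) atTop
      (𝓝 (1 / (k.factorial : ℝ))) := by
  have h1 : Tendsto (fun n : ℕ => (n.choose k : ℝ) / ((n : ℝ) ^ k / (k.factorial : ℝ))) atTop
      (𝓝 1) := by
    refine (Asymptotics.isEquivalent_iff_tendsto_one ?_).1 (isEquivalent_choose k)
    filter_upwards [eventually_gt_atTop 0] with n hn
    positivity
  have h2 := (h1.comp (tendsto_add_atTop_nat b)).mul_const (1 / (k.factorial : ℝ))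
  have h3 : Tendsto (fun n : ℕ => ((n + b : ℕ) / (n : ℝ)) ^ k) atTop (𝓝 (1 ^ k)) := by
    refine Tendsto.pow ?_ k
    have h4 : Tendsto (fun n : ℕ => 1 + (b : ℝ) / (n : ℝ)) atTop (𝓝 (1 + 0)) :=
      tendsto_const_nhds.add (tendsto_const_div_atTop_nhds_zero_nat _)
    rw [add_zero] at h4
    refine h4.congr' ?_
    filter_upwards [eventually_gt_atTop 0] with n hn
    push_cast
    field_simp
  have h5 := h2.mul h3
  rw [one_pow, one_mul, mul_one] at h5
  refine h5.congr' ?_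
  filter_upwards [eventually_gt_atTop 0] with n hn
  have : ((n + b : ℕ) : ℝ) ≠ 0 := by positivity
  simp only [Function.comp, div_pow]
  field_simp

lemma tendsto_choose_div_pow_of_lt (b : ℕ) {k D : ℕ} (h : k < D) :
    Tendsto (fun n : ℕ => ((n + b).choose k : ℝ) / (n : ℝ) ^ D) atTop (𝓝 0) := by
  have h1 := (tendsto_choose_div_pow b k).mul
    ((tendsto_pow_atTop (α := ℝ) (Nat.sub_ne_zero_of_lt h)).comp
      tendsto_natCast_atTop_atTop).inv_tendsto_atTop
  rw [mul_zero] at h1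
  refine h1.congr fun n => ?_
  simp only [Pi.inv_apply, Function.comp]
  rw [← div_eq_mul_inv, div_div, ← pow_add, Nat.add_sub_cancel' h.le]

lemma tendsto_sum_choose_div_pow (D : ℕ) (a : ℕ → ℝ) (b : ℕ → ℕ → ℕ)
    (hb : ∀ i ≤ D, ∃ c, ∀ n, b n i = n + c) :
    Tendsto (fun n : ℕ => (∑ i ∈ Finset.range (D + 1), a i * ((b n i).choose (D - i) : ℝ)) /
      (n : ℝ) ^ D) atTop (𝓝 (a 0 / (D.factorial : ℝ))) := by
  have h1 : ∀ i ∈ Finset.range (D + 1), Tendsto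
      (fun n : ℕ => a i * (((b n i).choose (D - i) : ℝ) / (n : ℝ) ^ D)) atTop
      (𝓝 (a i * if i = 0 then 1 / (D.factorial : ℝ) else 0)) := by
    intro i hi
    rw [Finset.mem_range] at hi
    obtain ⟨c, hc⟩ := hb i (by omega)
    simp only [hc]
    refine Tendsto.const_mul _ ?_
    split_ifs with h0
    · subst h0
      exact tendsto_choose_div_pow c D
    · exact tendsto_choose_div_pow_of_lt c (by omega)
  have h2 := tendsto_finsetSum _ h1
  convert h2 using 2
  · rw [Finset.sum_div]
    exact Finset.sum_congr rfl fun i _ => mul_div_assoc _ _ _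
  · simp [div_eq_mul_inv]

lemma hilbert_coefficients_eq_of_bounds {e : ℕ} {eI eQ f : ℕ → ℤ} {B c : ℕ}
    (h1 : ∀ᶠ n : ℕ in atTop, (B : ℤ) * ((n + 1 + (e + 1)).choose (e + 1) : ℤ) ≤
      (∑ i ∈ Finset.range (e + 2 + 1),
        (-1 : ℤ) ^ i * eQ i * ((n + 1 + (e + 2) - i).choose (e + 2 - i) : ℤ)) -
      ∑ i ∈ Finset.range (e + 2 + 1),
        (-1 : ℤ) ^ i * eI i * ((n + 1 + (e + 2) - i).choose (e + 2 - i) : ℤ))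
    (h2 : ∀ᶠ n : ℕ in atTop, (∑ i ∈ Finset.range (e + 2 + 1),
        (-1 : ℤ) ^ i * eQ i * ((n + 1 + (e + 2) - i).choose (e + 2 - i) : ℤ)) -
      ∑ i ∈ Finset.range (e + 2 + 1),
        (-1 : ℤ) ^ i * eI i * ((n + 1 + (e + 2) - i).choose (e + 2 - i) : ℤ) ≤
      ∑ i ∈ Finset.range (e + 2),
        (-1 : ℤ) ^ i * f i * ((n + 2 + (e + 2 - 1) - i).choose (e + 2 - 1 - i) : ℤ))
    (h3 : ∀ᶠ n : ℕ in atTop, ∑ i ∈ Finset.range (e + 2),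
        (-1 : ℤ) ^ i * f i * ((n + 2 + (e + 2 - 1) - i).choose (e + 2 - 1 - i) : ℤ) ≤
      (B : ℤ) * ((n + 1 + e + 1).choose (e + 1) : ℤ) + c * ((n + 1 + e + 1).choose e : ℤ) + c) :
    eI 1 - eQ 1 = B ∧ f 0 = B := by
  have hD : (((e + 1).factorial : ℕ) : ℝ) ≠ 0 := by positivity
  have hB : Tendsto (fun n : ℕ => (B : ℝ) * ((n + 1 + (e + 1)).choose (e + 1) : ℝ) /
      (n : ℝ) ^ (e + 1)) atTop (𝓝 (B / ((e + 1).factorial : ℝ))) := by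
    have := (tendsto_choose_div_pow (1 + (e + 1)) (e + 1)).const_mul (B : ℝ)
    simpa only [mul_one_div, mul_div_assoc, add_assoc] using this
  have hU : Tendsto (fun n : ℕ => ((B : ℝ) * ((n + 1 + e + 1).choose (e + 1) : ℝ) +
      c * ((n + 1 + e + 1).choose e : ℝ) + c) / (n : ℝ) ^ (e + 1)) atTop
      (𝓝 (B / ((e + 1).factorial : ℝ))) := by
    have h4 := (tendsto_choose_div_pow_of_lt (1 + e + 1) (Nat.lt_succ_self e)).const_mul (c : ℝ)
    have h5 := (tendsto_choose_div_pow_of_lt 0 (Nat.succ_pos e)).const_mul (c : ℝ)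
    have h6 := (hB.add h4).add h5
    simp only [mul_zero, add_zero] at h6
    refine h6.congr fun n => ?_
    simp only [Nat.choose_zero_right, ← add_assoc, Nat.cast_one, Nat.succ_eq_add_one]
    ring
  have hf : Tendsto (fun n : ℕ => (∑ i ∈ Finset.range (e + 1 + 1),
      (-1 : ℝ) ^ i * f i * ((n + 2 + (e + 2 - 1) - i).choose (e + 2 - 1 - i) : ℝ)) /
      (n : ℝ) ^ (e + 1)) atTop (𝓝 (((-1) ^ 0 * f 0) / ((e + 1).factorial : ℝ))) :=
    tendsto_sum_choose_div_pow (e + 1) (fun i => (-1 : ℝ) ^ i * f i) _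
      fun i hi => ⟨2 + (e + 2 - 1) - i, fun n => by omega⟩
  have hP : Tendsto (fun n : ℕ => (∑ i ∈ Finset.range (e + 2 + 1),
      (-1 : ℝ) ^ i * (eQ i - eI i) * ((n + 1 + (e + 2) - i).choose (e + 2 - i) : ℝ)) /
      (n : ℝ) ^ (e + 2)) atTop (𝓝 (((-1) ^ 0 * (eQ 0 - eI 0)) / ((e + 2).factorial : ℝ))) :=
    tendsto_sum_choose_div_pow (e + 2) (fun i => (-1 : ℝ) ^ i * (eQ i - eI i)) _
      fun i hi => ⟨1 + (e + 2) - i, fun n => by omega⟩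
  have hP' : Tendsto (fun n : ℕ => (∑ i ∈ Finset.range (e + 1 + 1),
      (-1 : ℝ) ^ (i + 1) * (eQ (i + 1) - eI (i + 1)) *
        ((n + 1 + (e + 2) - (i + 1)).choose (e + 1 - i) : ℝ)) /
      (n : ℝ) ^ (e + 1)) atTop (𝓝 (((-1) ^ (0 + 1) * (eQ (0 + 1) - eI (0 + 1))) /
        ((e + 1).factorial : ℝ))) :=
    tendsto_sum_choose_div_pow (e + 1) (fun i => (-1 : ℝ) ^ (i + 1) * (eQ (i + 1) - eI (i + 1))) _
      fun i hi => ⟨1 + (e + 2) - (i + 1), fun n => by omega⟩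
  have hinv : Tendsto (fun n : ℕ => (n : ℝ)⁻¹) atTop (𝓝 0) :=
    tendsto_inv_atTop_zero.comp tendsto_natCast_atTop_atTop
  have hB' := hB.mul hinv
  have hU' := hU.mul hinv
  rw [mul_zero] at hB' hU'
  have h1r : ∀ᶠ n : ℕ in atTop, (B : ℝ) * ((n + 1 + (e + 1)).choose (e + 1) : ℝ) ≤
      ∑ i ∈ Finset.range (e + 2 + 1),
      (-1 : ℝ) ^ i * (eQ i - eI i) * ((n + 1 + (e + 2) - i).choose (e + 2 - i) : ℝ) := by
    filter_upwards [h1] with n hn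
    rw [← Finset.sum_sub_distrib] at hn
    simp only [mul_sub, sub_mul]
    exact_mod_cast hn
  have h2r : ∀ᶠ n : ℕ in atTop, ∑ i ∈ Finset.range (e + 2 + 1),
      (-1 : ℝ) ^ i * (eQ i - eI i) * ((n + 1 + (e + 2) - i).choose (e + 2 - i) : ℝ) ≤
      ∑ i ∈ Finset.range (e + 1 + 1),
      (-1 : ℝ) ^ i * f i * ((n + 2 + (e + 2 - 1) - i).choose (e + 2 - 1 - i) : ℝ) := by
    filter_upwards [h2] with n hn
    rw [← Finset.sum_sub_distrib] at hn
    simp only [mul_sub, sub_mul]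
    exact_mod_cast hn
  have h3r : ∀ᶠ n : ℕ in atTop, ∑ i ∈ Finset.range (e + 1 + 1),
      (-1 : ℝ) ^ i * f i * ((n + 2 + (e + 2 - 1) - i).choose (e + 2 - 1 - i) : ℝ) ≤
      (B : ℝ) * ((n + 1 + e + 1).choose (e + 1) : ℝ) +
      c * ((n + 1 + e + 1).choose e : ℝ) + c := by
    filter_upwards [h3] with n hn
    exact_mod_cast hn
  have h0 : (eQ 0 : ℝ) - eI 0 = 0 := by
    have h4 := tendsto_nhds_unique hP (tendsto_of_tendsto_of_tendsto_of_le_of_le' hB' hU' ?_ ?_)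
    · have : (((e + 2).factorial : ℕ) : ℝ) ≠ 0 := by positivity
      simpa [this] using h4
    · filter_upwards [h1r] with n hn
      rw [← div_eq_mul_inv, div_div, ← pow_succ]
      gcongr
    · filter_upwards [h2r, h3r] with n hn hn'
      rw [← div_eq_mul_inv, div_div, ← pow_succ]
      have := hn.trans hn'
      gcongr
  have hsum : ∀ n : ℕ, ∑ i ∈ Finset.range (e + 2 + 1),
      (-1 : ℝ) ^ i * (eQ i - eI i) * ((n + 1 + (e + 2) - i).choose (e + 2 - i) : ℝ) =
      ∑ i ∈ Finset.range (e + 1 + 1), (-1 : ℝ) ^ (i + 1) * (eQ (i + 1) - eI (i + 1)) *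
        ((n + 1 + (e + 2) - (i + 1)).choose (e + 1 - i) : ℝ) := by
    intro n
    rw [Finset.sum_range_succ', h0, mul_zero, zero_mul, add_zero]
    refine Finset.sum_congr rfl fun i _ => ?_
    rw [show e + 2 - (i + 1) = e + 1 - i by omega]
  constructor
  · have h4 := tendsto_nhds_unique hP' (tendsto_of_tendsto_of_tendsto_of_le_of_le' hB hU ?_ ?_)
    · rw [div_left_inj' hD] at h4
      have h5 : (eI 1 : ℝ) - eQ 1 = B := by rw [← h4]; ring
      exact_mod_cast h5
    · filter_upwards [h1r] with n hn
      rw [hsum] at hn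
      gcongr
    · filter_upwards [h2r, h3r] with n hn hn'
      rw [hsum] at hn
      have := hn.trans hn'
      gcongr
  · have h4 := tendsto_nhds_unique hf (tendsto_of_tendsto_of_tendsto_of_le_of_le' hB hU ?_ ?_)
    · rw [div_left_inj' hD, pow_zero, one_mul] at h4
      exact_mod_cast h4
    · filter_upwards [h1r, h2r] with n hn hn'
      have := hn.trans hn'
      gcongr
    · filter_upwards [h3r] with n hn
      gcongr

end BinomialAsymptotics

section HilbertBounds

variable {R : Type} [CommRing R]

lemma pow_succ_succ_eq_of_sq_eq {I q : Ideal R} (h : I ^ 2 = q * I) (n : ℕ) :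
    I ^ (n + 2) = q ^ (n + 1) * I := by
  induction n with
  | zero => simpa using h
  | succ n ih => rw [pow_succ, ih, mul_assoc, ← sq, h, ← mul_assoc, ← pow_succ]

lemma relLength_pow_succ_mul_colon_le [IsLocalRing R] (q : Ideal R) (n : ℕ) :
    relLength (q ^ (n + 2)) (q ^ (n + 1) * q.colon (maximalIdeal R : Set R)) ≤
      relLength (q ^ (n + 2)) ((q ^ (n + 2)).colon (maximalIdeal R : Set R)) := by
  refine relLength_mono_right _ (Ideal.mul_le.2 fun a ha b hb => mem_colon_ideal.2 fun t ht => ?_)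
  rw [mul_left_comm, pow_succ q (n + 1)]
  exact Ideal.mul_mem_mul ha (mem_colon_ideal.1 hb t ht)

lemma length_quotient_pow_eq_add {I q : Ideal R} (hqI : q ≤ I) (h : I ^ 2 = q * I) (n : ℕ) :
    Module.length R (R ⧸ q ^ (n + 2)) =
      relLength (q ^ (n + 2)) (q ^ (n + 1) * I) + Module.length R (R ⧸ I ^ (n + 2)) := by
  rw [length_quotient_eq_relLength, length_quotient_eq_relLength,
    relLength_add (Ideal.pow_right_mono hqI (n + 2)) ⊤, top_inf_eq, pow_succ_succ_eq_of_sq_eq h]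

end HilbertBounds

section LengthConversion

lemma moduleLength_eq_length (S M : Type) [CommRing S] [AddCommGroup M] [Module S M] :
    moduleLength S M = ((Module.length S M : ℕ∞) : WithBot ℕ∞) :=
  (Module.coe_length S M).symm

lemma indexOfReducibility_eq_relLength (S : Type) [CommRing S] [IsLocalRing S] (q : Ideal S) :
    indexOfReducibility S q = (relLength q (q.colon (maximalIdeal S : Set S)) : ℕ∞) := by
  rw [indexOfReducibility, moduleLength_eq_length, ← length_quotient_comap_subtype]

lemma socLocalCohomology_eq_socleLength (S : Type) [CommRing S] [IsLocalRing S] (i : ℕ) :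
    socLocalCohomology S i = (socleLength S (LC (maximalIdeal S) i S) : ℕ∞) :=
  moduleLength_eq_length _ _

end LengthConversion

/-- Lemma 4.2: let `R` be a generalized Cohen–Macaulay Noetherian local ring of dimension
`d ≥ 2` with infinite residue field and `𝔮 = (x₁,…,x_d)` a standard parameter ideal with
`I² = 𝔮I`, where `I = 𝔮 :_R 𝔪`, and `𝒩(𝔮;R) = Σ_{i=0}^d C(d,i)·r_i(R)`. Then
`e₁(I) - e₁(𝔮) = f₀(𝔮) = Σ_{j=1}^d C(d-1,j-1)·r_j(R)`. -/
theorem stmt_13 [IsNoetherianRing R] (d : ℕ)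
    (hdim : ringKrullDim R = (d : WithBot ℕ∞)) (hd : 2 ≤ d)
    (hres : Infinite (ResidueField R)) (hgCM : IsGeneralizedCM R d)
    (x : Fin d → R) (hstd : IsStandardSOP R d x)
    (q : Ideal R) (hq : q = Ideal.span (Set.range x))
    (hqI : (q.colon (maximalIdeal R)) ^ 2 = q * (q.colon (maximalIdeal R)))
    (hN : indexOfReducibility R q =
      ∑ i ∈ Finset.range (d + 1), d.choose i • socLocalCohomology R i) :
    ∀ eI eQ f : ℕ → ℤ, IsHilbertCoeffs R d (q.colon (maximalIdeal R)) eI →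
      IsHilbertCoeffs R d q eQ → IsIrrCoeffs R d q f →
      ∀ r : ℕ → ℕ, (∀ j, socLocalCohomology R j = (r j : ℕ∞)) →
        eI 1 - eQ 1 = f 0 ∧
        f 0 = ∑ j ∈ Finset.Icc 1 d, ((d - 1).choose (j - 1) : ℤ) * (r j : ℤ) := by
  obtain ⟨e, rfl⟩ : ∃ e, d = e + 2 := ⟨d - 2, by omega⟩
  subst hq
  obtain ⟨hrad, hx⟩ := hstd
  intro eI eQ f ⟨NI, hI⟩ ⟨NQ, hQ⟩ ⟨Nf, hf⟩ r hr
  simp only [moduleLength_eq_length, indexOfReducibility_eq_relLength, WithBot.coe_inj]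
    at hI hQ hf
  have hr' : ∀ i, socleLength R (LC (maximalIdeal R) i R) = r i := fun i =>
    WithBot.coe_injective ((socLocalCohomology_eq_socleLength R i).symm.trans (hr i))
  have hN' : relLength (Ideal.span (Set.range x))
      ((Ideal.span (Set.range x)).colon (maximalIdeal R : Set R)) =
      ((∑ i ∈ Finset.range (e + 3), (e + 2).choose i * r i : ℕ) : ℕ∞) := by
    refine WithBot.coe_injective ((indexOfReducibility_eq_relLength R _).symm.trans (hN.trans ?_))
    simp only [hr, nsmul_eq_mul]
    push_cast
    rfl
  have hsat := isSaturatedSeq_of_local_cohomology hrad hx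
  have hqm : Ideal.span (Set.range x) ≤ maximalIdeal R := hrad ▸ Ideal.le_radical
  have hqcolon : Ideal.span (Set.range x) ≤
      (Ideal.span (Set.range x)).colon (maximalIdeal R : Set R) :=
    fun a ha => mem_colon_ideal.2 fun b _ => Ideal.mul_mem_left _ b ha
  have hs := socleLength_quotient_filtrationIdeal_le hrad hx hr'
  have hs' := le_relLength_filtrationIdeal_colon hrad hx hr' hN'.ge
  set B := ∑ l ∈ Finset.range (e + 2), (e + 1).choose l * r (1 + l)
  set q := Ideal.span (Set.range x)
  obtain ⟨c, hc⟩ : ∃ c : ℕ, Module.length R (R ⧸ q) = c := by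
    obtain ⟨L, hL, -⟩ := hQ NQ le_rfl
    refine ⟨_, (ENat.natCast_toNat (ne_top_of_le_ne_top (ENat.natCast_ne_top L) ?_)).symm⟩
    rw [← hL, length_quotient_eq_relLength, length_quotient_eq_relLength]
    exact relLength_anti_left (Ideal.pow_le_self (Nat.succ_ne_zero NQ)) _
  have key : ∀ n ≥ NI + NQ + Nf,
      (B : ℤ) * ((n + 1 + (e + 1)).choose (e + 1) : ℤ) ≤
        (∑ i ∈ Finset.range (e + 2 + 1),
          (-1 : ℤ) ^ i * eQ i * ((n + 1 + (e + 2) - i).choose (e + 2 - i) : ℤ)) -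
        ∑ i ∈ Finset.range (e + 2 + 1),
          (-1 : ℤ) ^ i * eI i * ((n + 1 + (e + 2) - i).choose (e + 2 - i) : ℤ) ∧
      (∑ i ∈ Finset.range (e + 2 + 1),
          (-1 : ℤ) ^ i * eQ i * ((n + 1 + (e + 2) - i).choose (e + 2 - i) : ℤ)) -
        ∑ i ∈ Finset.range (e + 2 + 1),
          (-1 : ℤ) ^ i * eI i * ((n + 1 + (e + 2) - i).choose (e + 2 - i) : ℤ) ≤
        ∑ i ∈ Finset.range (e + 2),
          (-1 : ℤ) ^ i * f i * ((n + 2 + (e + 2 - 1) - i).choose (e + 2 - 1 - i) : ℤ) ∧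
      ∑ i ∈ Finset.range (e + 2),
          (-1 : ℤ) ^ i * f i * ((n + 2 + (e + 2 - 1) - i).choose (e + 2 - 1 - i) : ℤ) ≤
        (B : ℤ) * ((n + 1 + e + 1).choose (e + 1) : ℤ) + c * ((n + 1 + e + 1).choose e : ℤ) +
          c := by
    intro n hn
    obtain ⟨LI, hLI, hLI'⟩ := hI (n + 1) (by omega)
    obtain ⟨LQ, hLQ, hLQ'⟩ := hQ (n + 1) (by omega)
    obtain ⟨LF, hLF, hLF'⟩ := hf (n + 2) (by omega)
    rw [← hLI', ← hLQ', ← hLF']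
    have h1 := length_quotient_pow_eq_add hqcolon hqI n
    have h2 := (mul_le_mul_left hs' _).trans
      (hsat.relLength_mul_choose_le (q.colon (maximalIdeal R : Set R)) n)
    have h3 := relLength_pow_succ_mul_colon_le q n
    have h4 := (hsat.relLength_colon_pow_le hqm n).trans
      (add_le_add_left (add_le_add_left (mul_le_mul_left hs _) _) _)
    rw [hLF] at h3 h4
    rw [hc] at h4
    obtain ⟨X, hX⟩ := ENat.ne_top_iff_exists.1 (ne_top_of_le_ne_top (ENat.natCast_ne_top LF) h3)
    rw [← hX] at h1 h2 h3
    rw [show n + 2 = n + 1 + 1 from rfl, hLI, hLQ] at h1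
    norm_cast at h1 h2 h3 h4
    refine ⟨?_, ?_, by exact_mod_cast h4⟩
    · zify at h1 h2
      linarith
    · zify at h1 h3
      linarith
  have hev : ∀ᶠ n in Filter.atTop, n ≥ NI + NQ + Nf := Filter.eventually_ge_atTop _
  obtain ⟨h1, h2⟩ := hilbert_coefficients_eq_of_bounds (hev.mono fun n hn => (key n hn).1)
    (hev.mono fun n hn => (key n hn).2.1) (hev.mono fun n hn => (key n hn).2.2)
  refine ⟨h1.trans h2.symm, h2.trans ?_⟩
  rw [← Finset.Ico_succ_right_eq_Icc, Finset.sum_Ico_eq_sum_range]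
  simp only [B, Nat.cast_sum, Nat.cast_mul]
  refine Finset.sum_congr (by simp) fun i _ => ?_
  simp

end
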